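/- Let α, β be real and k an integer, with α ∉ ℤ and β ∉ ℤ if k = 1. Let τ ∈ ℂ with Re τ > 0, q := e^{−2πτ}, q̂ := e^{−2π/τ}. Then δ(β)·ζ_α(k) + 𝒮_k(β,0;0,α;q) + (−1)^{k−1}·𝒮_k(−β,0;0,−α;q) − (−2π)^k·Σ_{j=0}^{k+1} ((−i)^j·B_j(⟨α⟩)·B_{k+1−j}(⟨β⟩)/(j!(k+1−j)!))·τ^{k−j} = (−iτ)^{k−1}·( δ(α)·ζ_{−β}(k) + 𝒮_k(α,0;0,−β;q̂) + (−1)^{k−1}·𝒮_k(−α,0;0,β;q̂) ), the j-sum being empty when k+1 < 0. -/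

import Mathlib

noncomputable section

open Complex MeasureTheory
open scoped Real Classical

/-- `e(s) = exp(2 π i s)`. -/
def ee (s : ℂ) : ℂ := Complex.exp (2 * (Real.pi : ℂ) * Complex.I * s)

/-- `δ(x) = 1` if `x ∈ ℤ`, `0` otherwise. -/
def dInt (x : ℝ) : ℂ := if ∃ n : ℤ, (n : ℝ) = x then 1 else 0

/-- The Lerch zeta function `ψ(r,γ,κ) = Σ_{k ∈ ℤ, γ+k>0} e((γ+k)κ) (γ+k)^{-r}`
(a convergent series when `Re r > 1`). -/
def psiL (r : ℂ) (γ κ : ℝ) : ℂ :=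
  ∑' k : {k : ℤ // 0 < γ + (k : ℝ)},
    ee ((((γ + (k.1 : ℝ)) * κ : ℝ)) : ℂ) * (((γ + (k.1 : ℝ)) : ℝ) : ℂ) ^ (-r)

/-- The `q`-series `𝒮_r(γ,δ;κ,λ;q)`, where `q = e^{-2πt}` with `Re t > 0`, and the power
`q^{(γ+k)(δ+l)}` is interpreted as `exp (-2πt(γ+k)(δ+l))`. -/
def Scal (r : ℂ) (γ δ' κ lam : ℝ) (t : ℂ) : ℂ :=
  ∑' (k : {k : ℤ // 0 < γ + (k : ℝ)}) (l : {l : ℤ // 0 < δ' + (l : ℝ)}),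
    ee ((((γ + (k.1 : ℝ)) * κ + (δ' + (l.1 : ℝ)) * lam : ℝ)) : ℂ) *
      (((δ' + (l.1 : ℝ)) : ℝ) : ℂ) ^ (-r) *
      Complex.exp (-2 * (Real.pi : ℂ) * t * ((γ + (k.1 : ℝ) : ℝ) : ℂ) * ((δ' + (l.1 : ℝ) : ℝ) : ℂ))

/-- The generalized Eisenstein series `F_{ℤ²}(s;α,β;μ,ν;z)` (mean of the two branch
conventions), defined by an absolutely convergent series for `Re s > 2`. -/
def Fz2 (s : ℂ) (α β μ ν : ℝ) (z : ℂ) : ℂ :=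
  (∑' p : {p : ℤ × ℤ // β + (p.2 : ℝ) ≠ 0},
      ee ((((α + (p.1.1 : ℝ)) * μ + (β + (p.1.2 : ℝ)) * ν : ℝ)) : ℂ) *
        ((((α + (p.1.1 : ℝ)) : ℝ) : ℂ) + (((β + (p.1.2 : ℝ)) : ℝ) : ℂ) * z) ^ (-s)) +
  dInt β *
    ((∑' m : {m : ℤ // 0 < α + (m : ℝ)},
        ee ((((α + (m.1 : ℝ)) * μ : ℝ)) : ℂ) * (((α + (m.1 : ℝ)) : ℝ) : ℂ) ^ (-s)) +
      Complex.cos ((Real.pi : ℂ) * s) *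
        ∑' m : {m : ℤ // α + (m : ℝ) < 0},
          ee ((((α + (m.1 : ℝ)) * μ : ℝ)) : ℂ) * ((|α + (m.1 : ℝ)| : ℝ) : ℂ) ^ (-s))

/-- `𝒜(s,α,μ) = cos(πs) ψ(s,-α,-μ) + ψ(s,α,μ)`. -/
def Acal (s : ℂ) (α μ : ℝ) : ℂ :=
  Complex.cos ((Real.pi : ℂ) * s) * psiL s (-α) (-μ) + psiL s α μ

/-- `ψ(k,γ,κ)` at an integer `k`: the convergent series for `k ≥ 2`, the value
`-𝒞_{1-k}(⟨γ⟩,κ)/(1-k) - δ_{k0} δ(γ)` of the analytic continuation for `k ≤ 0`,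
and the (irrelevant) value `0` for `k = 1`; here `C` is the family of Taylor
coefficients `𝒞`. -/
def psiIntC (C : ℕ → ℂ → ℝ → ℂ) (k : ℤ) (γ κ : ℝ) : ℂ :=
  if 2 ≤ k then
    ∑' n : {n : ℤ // 0 < γ + (n : ℝ)},
      ee ((((γ + (n.1 : ℝ)) * κ : ℝ)) : ℂ) * (((γ + (n.1 : ℝ)) : ℝ) : ℂ) ^ (-k)
  else if k ≤ 0 then
    -C (1 - k).toNat ((Int.fract γ : ℝ) : ℂ) κ / ((1 : ℂ) - (k : ℂ)) -
      (if k = 0 then dInt γ else 0)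
  else 0

/-- The Bernoulli polynomial `B_j(x)` evaluated in `ℂ`. -/
def BpolyC (j : ℕ) (x : ℂ) : ℂ := Polynomial.aeval x (Polynomial.bernoulli j)

/-- Weierstrass `℘`-function with periods `(1, z)`. -/
def wpFn (z w : ℂ) : ℂ :=
  w ^ (-2 : ℤ) + ∑' p : {p : ℤ × ℤ // p ≠ (0, 0)},
    ((w - (p.1.1 : ℂ) - (p.1.2 : ℂ) * z) ^ (-2 : ℤ) -
      ((p.1.1 : ℂ) + (p.1.2 : ℂ) * z) ^ (-2 : ℤ))

/-- Weierstrass zeta function with periods `(1, z)`. -/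
def wzetaFn (z w : ℂ) : ℂ :=
  1 / w + ∑' p : {p : ℤ × ℤ // p ≠ (0, 0)},
    (1 / (w - (p.1.1 : ℂ) - (p.1.2 : ℂ) * z) + 1 / ((p.1.1 : ℂ) + (p.1.2 : ℂ) * z) +
      w / ((p.1.1 : ℂ) + (p.1.2 : ℂ) * z) ^ 2)

/-- Weierstrass sigma function with periods `(1, z)`. -/
def wsigmaFn (z w : ℂ) : ℂ :=
  w * ∏' p : {p : ℤ × ℤ // p ≠ (0, 0)},
    ((1 - w / ((p.1.1 : ℂ) + (p.1.2 : ℂ) * z)) *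
      Complex.exp (w / ((p.1.1 : ℂ) + (p.1.2 : ℂ) * z) +
        w ^ 2 / (2 * ((p.1.1 : ℂ) + (p.1.2 : ℂ) * z) ^ 2)))

/-- The `q`-Pochhammer symbol `(Z;q)_∞`. -/
def qPoch (Z q : ℂ) : ℂ := ∏' l : ℕ, (1 - Z * q ^ l)

/-- `⟨x⟩' = 1 - ⟨-x⟩`. -/
def fracP (x : ℝ) : ℝ := 1 - Int.fract (-x)

/-- The Eisenstein series `E₂`. -/
def E2cl (z : ℂ) : ℂ := 1 - 24 * ∑' l : ℕ+, (l : ℂ) * ee z ^ (l : ℕ) / (1 - ee z ^ (l : ℕ))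

/-- `a_{2k}`: `ζ(1-2k)` for `k ≠ 0` and `2ζ'(0) = -log 2π` for `k = 0`. -/
def acoef (k : ℤ) : ℂ :=
  if k = 0 then -(Real.log (2 * Real.pi) : ℂ) else riemannZeta ((1 - 2 * k : ℤ) : ℂ)

/-- The classical Eisenstein series `E_{2k}`. -/
def Ecl (k : ℤ) (z : ℂ) : ℂ :=
  1 + (2 / acoef k) * ∑' l : ℕ+, (l : ℂ) ^ (2 * k - 1) * ee z ^ (l : ℕ) / (1 - ee z ^ (l : ℕ))

/-- The bilateral Lerch zeta function `ψ_ℤ^ε(r,γ,κ) = e^{-επir} ψ(r,-γ,-κ) + ψ(r,γ,κ)`. -/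
def psiZpm (ε : ℤ) (r : ℂ) (γ κ : ℝ) : ℂ :=
  Complex.exp (-(ε : ℂ) * (Real.pi : ℂ) * Complex.I * r) * psiL r (-γ) (-κ) + psiL r γ κ

section

open Filter Topology

/-- The Dirichlet-type series `∑ c_n exp (-(n+1) w)`. -/
def expSeries (c : ℕ → ℂ) (w : ℂ) : ℂ :=
  ∑' n : ℕ, c n * Complex.exp (-(((n : ℂ) + 1) * w))

/-- Growth of order at most `n ^ m`. -/
def PowBound (c : ℕ → ℂ) (m : ℤ) : Prop :=
  ∃ C : ℝ, ∀ n : ℕ, ‖c n‖ ≤ C * ((n : ℝ) + 1) ^ m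

theorem norm_exp_neg_natSucc_mul (n : ℕ) (w : ℂ) :
    ‖Complex.exp (-(((n : ℂ) + 1) * w))‖ = Real.exp (-(((n : ℝ) + 1) * w.re)) := by
  rw [Complex.norm_exp]
  simp

theorem summable_natSucc_zpow_mul_exp (m : ℤ) {r : ℝ} (hr : 0 < r) :
    Summable fun n : ℕ => ((n : ℝ) + 1) ^ m * Real.exp (-(((n : ℝ) + 1) * r)) := by
  have h := (summable_nat_add_iff 1).mpr (Real.summable_pow_mul_exp_neg_nat_mul m.toNat hr)
  refine h.of_nonneg_of_le (fun n => by positivity) (fun n => ?_)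
  push_cast
  have : ((n : ℝ) + 1) ^ m ≤ ((n : ℝ) + 1) ^ m.toNat := by
    rw [← zpow_natCast]
    exact zpow_le_zpow_right₀ (by linarith [n.cast_nonneg (α := ℝ)]) (Int.self_le_toNat m)
  have h2 : -(((n : ℝ) + 1) * r) = -r * ((n : ℝ) + 1) := by ring
  rw [h2]
  gcongr

theorem summable_natSucc_zpow {m : ℤ} (hm : m ≤ -2) :
    Summable fun n : ℕ => ((n : ℝ) + 1) ^ m := by
  have h := (summable_nat_add_iff 1).mpr (Real.summable_nat_pow_inv (p := 2) |>.mpr (by norm_num))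
  refine h.of_nonneg_of_le (fun n => by positivity) (fun n => ?_)
  push_cast
  have : ((n : ℝ) + 1) ^ m ≤ ((n : ℝ) + 1) ^ (-2 : ℤ) :=
    zpow_le_zpow_right₀ (by linarith [n.cast_nonneg (α := ℝ)]) hm
  exact this.trans_eq (by rw [zpow_neg]; norm_cast)

theorem PowBound.natSucc_mul {c : ℕ → ℂ} {m : ℤ} (h : PowBound c m) :
    PowBound (fun n => ((n : ℂ) + 1) * c n) (m + 1) := by
  obtain ⟨C, hC⟩ := h
  refine ⟨C, fun n => ?_⟩
  have h0 : (0 : ℝ) < (n : ℝ) + 1 := by positivity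
  have h1 : ‖(n : ℂ) + 1‖ = (n : ℝ) + 1 := by
    rw [← Nat.cast_succ, Complex.norm_natCast]; push_cast; rfl
  rw [norm_mul, zpow_add_one₀ h0.ne', h1]
  nlinarith [hC n]

theorem norm_expSeries_term_le {c : ℕ → ℂ} {m : ℤ} {C : ℝ}
    (hC : ∀ n : ℕ, ‖c n‖ ≤ C * ((n : ℝ) + 1) ^ m) {w : ℂ} {r : ℝ} (hr : r ≤ w.re) (n : ℕ) :
    ‖c n * Complex.exp (-(((n : ℂ) + 1) * w))‖ ≤
      C * (((n : ℝ) + 1) ^ m * Real.exp (-(((n : ℝ) + 1) * r))) := by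
  rw [norm_mul, norm_exp_neg_natSucc_mul, ← mul_assoc]
  gcongr
  · exact (norm_nonneg _).trans (hC n)
  · exact hC n

theorem summable_expSeries {c : ℕ → ℂ} {m : ℤ} (h : PowBound c m) {w : ℂ} (hw : 0 < w.re) :
    Summable fun n : ℕ => c n * Complex.exp (-(((n : ℂ) + 1) * w)) := by
  obtain ⟨C, hC⟩ := h
  exact Summable.of_norm_bounded ((summable_natSucc_zpow_mul_exp m hw).mul_left C)
    (fun n => norm_expSeries_term_le hC le_rfl n)

theorem summable_expSeries_of_nonneg {c : ℕ → ℂ} {m : ℤ} (h : PowBound c m) (hm : m ≤ -2)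
    {w : ℂ} (hw : 0 ≤ w.re) :
    Summable fun n : ℕ => c n * Complex.exp (-(((n : ℂ) + 1) * w)) := by
  obtain ⟨C, hC⟩ := h
  refine Summable.of_norm_bounded ((summable_natSucc_zpow hm).mul_left C) (fun n => ?_)
  simpa using norm_expSeries_term_le hC hw n

theorem continuousOn_expSeries {c : ℕ → ℂ} {m : ℤ} (h : PowBound c m) (hm : m ≤ -2) :
    ContinuousOn (expSeries c) {w : ℂ | 0 ≤ w.re} := by
  obtain ⟨C, hC⟩ := h
  refine continuousOn_tsum (fun n => by fun_prop) ((summable_natSucc_zpow hm).mul_left C)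
    (fun n w hw => ?_)
  simpa using norm_expSeries_term_le hC hw n

theorem hasDerivAt_expSeries {c : ℕ → ℂ} {m : ℤ} (h : PowBound c m) {w : ℂ} (hw : 0 < w.re) :
    HasDerivAt (expSeries c) (-expSeries (fun n => ((n : ℂ) + 1) * c n) w) w := by
  have hS := summable_expSeries h hw
  obtain ⟨C, hC⟩ := h.natSucc_mul
  have hr : 0 < w.re / 2 := by linarith
  have := hasDerivAt_tsum_of_isPreconnected
    (g := fun (n : ℕ) w => c n * Complex.exp (-(((n : ℂ) + 1) * w)))
    (g' := fun (n : ℕ) w => -(((n : ℂ) + 1) * c n * Complex.exp (-(((n : ℂ) + 1) * w))))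
    (t := {z : ℂ | w.re / 2 < z.re}) (y₀ := w) (y := w)
    ((summable_natSucc_zpow_mul_exp (m + 1) hr).mul_left C)
    (isOpen_lt continuous_const Complex.continuous_re)
    (convex_halfSpace_re_gt _).isPreconnected
    (fun n y _ => by
      have := (((hasDerivAt_id y).const_mul ((n : ℂ) + 1)).neg.cexp).const_mul (c n)
      refine this.congr_deriv ?_
      simp only [id, Pi.neg_apply]; ring)
    (fun n y hy => by
      rw [norm_neg]
      exact norm_expSeries_term_le hC (le_of_lt hy) n)
    (by simp; linarith) hS (by simp; linarith)
  rw [tsum_neg] at this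
  exact this

theorem expSeries_add_two_pi_I (c : ℕ → ℂ) (w : ℂ) :
    expSeries c (w + 2 * π * I) = expSeries c w := by
  unfold expSeries
  refine tsum_congr fun n => ?_
  rw [show -(((n : ℂ) + 1) * (w + 2 * π * I)) =
    -(((n : ℂ) + 1) * w) + ((-(n + 1) : ℤ) : ℂ) * (2 * π * I) by push_cast; ring,
    Complex.exp_add, Complex.exp_int_mul_two_pi_mul_I, mul_one]

theorem expSeries_sub_two_pi_I (c : ℕ → ℂ) (w : ℂ) :
    expSeries c (w - 2 * π * I) = expSeries c w := by
  rw [← expSeries_add_two_pi_I c (w - 2 * π * I), sub_add_cancel]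

/-- Coefficients of the polylogarithm of order `k`. -/
def liCoeff (k : ℤ) (n : ℕ) : ℂ := ((n : ℂ) + 1) ^ (-k)

/-- Coefficients `n ^ (-k) / (1 - q ^ n)` with `q = exp (-2 π t)`. -/
def lambertCoeff (k : ℤ) (t : ℂ) (n : ℕ) : ℂ :=
  liCoeff k n / (1 - Complex.exp (-(((n : ℂ) + 1) * (2 * π * t))))

theorem powBound_liCoeff (k : ℤ) : PowBound (liCoeff k) (-k) := by
  refine ⟨1, fun n => ?_⟩
  rw [liCoeff, norm_zpow, ← Nat.cast_succ, Complex.norm_natCast]; push_cast; simp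

theorem re_two_pi_mul (t : ℂ) : (2 * π * t : ℂ).re = 2 * π * t.re := by
  simp

theorem norm_exp_lt_one {t : ℂ} (ht : 0 < t.re) (n : ℕ) :
    ‖Complex.exp (-(((n : ℂ) + 1) * (2 * π * t)))‖ ≤ Real.exp (-(2 * π * t.re)) := by
  rw [norm_exp_neg_natSucc_mul, re_two_pi_mul, Real.exp_le_exp]
  have : 0 < 2 * π * t.re := by positivity
  nlinarith [n.cast_nonneg (α := ℝ)]

theorem one_sub_exp_ne_zero {t : ℂ} (ht : 0 < t.re) (n : ℕ) :
    1 - Complex.exp (-(((n : ℂ) + 1) * (2 * π * t))) ≠ 0 := by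
  intro h
  have h1 := norm_exp_lt_one ht n
  rw [← sub_eq_zero.mp h, norm_one] at h1
  have : Real.exp (-(2 * π * t.re)) < 1 := by
    rw [Real.exp_lt_one_iff]; have : 0 < 2 * π * t.re := by positivity
    linarith
  linarith

theorem powBound_lambertCoeff (k : ℤ) {t : ℂ} (ht : 0 < t.re) :
    PowBound (lambertCoeff k t) (-k) := by
  have hq : Real.exp (-(2 * π * t.re)) < 1 := by
    rw [Real.exp_lt_one_iff]; have : 0 < 2 * π * t.re := by positivity
    linarith
  refine ⟨1 / (1 - Real.exp (-(2 * π * t.re))), fun n => ?_⟩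
  have hli : ‖liCoeff k n‖ = ((n : ℝ) + 1) ^ (-k) := by
    rw [liCoeff, norm_zpow, ← Nat.cast_succ, Complex.norm_natCast]; push_cast; rfl
  rw [lambertCoeff, norm_div, hli, div_eq_mul_inv, mul_comm, one_div]
  have hpos : 0 < 1 - Real.exp (-(2 * π * t.re)) := by linarith
  gcongr
  calc 1 - Real.exp (-(2 * π * t.re)) ≤
        ‖(1 : ℂ)‖ - ‖Complex.exp (-(((n : ℂ) + 1) * (2 * π * t)))‖ := by
        rw [norm_one]; linarith [norm_exp_lt_one ht n]
    _ ≤ _ := norm_sub_norm_le _ _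

theorem natSucc_mul_liCoeff (k : ℤ) (n : ℕ) :
    ((n : ℂ) + 1) * liCoeff k n = liCoeff (k - 1) n := by
  have : (n : ℂ) + 1 ≠ 0 := Nat.cast_add_one_ne_zero n
  rw [liCoeff, liCoeff, neg_sub, sub_eq_add_neg, zpow_add₀ this, zpow_one]

theorem natSucc_mul_lambertCoeff (k : ℤ) (t : ℂ) (n : ℕ) :
    ((n : ℂ) + 1) * lambertCoeff k t n = lambertCoeff (k - 1) t n := by
  rw [lambertCoeff, lambertCoeff, ← natSucc_mul_liCoeff, mul_div_assoc]

/-- The Lambert series `∑ n ^ (-k) exp (-n w) / (1 - q ^ n)`. -/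
def lambertU (k : ℤ) (t w : ℂ) : ℂ := expSeries (lambertCoeff k t) w

theorem hasDerivAt_lambertU (k : ℤ) {t w : ℂ} (ht : 0 < t.re) (hw : 0 < w.re) :
    HasDerivAt (lambertU k t) (-lambertU (k - 1) t w) w := by
  have := hasDerivAt_expSeries (powBound_lambertCoeff k ht) hw
  simp_rw [natSucc_mul_lambertCoeff] at this
  exact this

theorem lambertU_sub_shift (k : ℤ) {t w : ℂ} (ht : 0 < t.re)
    (hw : 0 < w.re ∨ 2 ≤ k ∧ 0 ≤ w.re) :
    lambertU k t w = expSeries (liCoeff k) w + lambertU k t (w + 2 * π * t) := by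
  have hre : 0 < (w + 2 * π * t).re := by
    rw [Complex.add_re, re_two_pi_mul]
    have : 0 < 2 * π * t.re := by positivity
    rcases hw with h | h <;> linarith
  have h1 : Summable fun n : ℕ => liCoeff k n * Complex.exp (-(((n : ℂ) + 1) * w)) := by
    rcases hw with h | h
    · exact summable_expSeries (powBound_liCoeff k) h
    · exact summable_expSeries_of_nonneg (powBound_liCoeff k) (by lia) h.2
  rw [lambertU, lambertU, expSeries, expSeries, expSeries,
    ← h1.tsum_add (summable_expSeries (powBound_lambertCoeff k ht) hre)]
  refine tsum_congr fun n => ?_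
  have h2 := one_sub_exp_ne_zero ht n
  rw [lambertCoeff, mul_add ((n : ℂ) + 1), neg_add, Complex.exp_add]
  generalize Complex.exp (-(((n : ℂ) + 1) * (2 * π * t))) = q at h2 ⊢
  field_simp
  ring

end

section

open Filter Topology

/-- The Bernoulli polynomial divided by `j!`. -/
def bernDiv (j : ℕ) (x : ℂ) : ℂ := BpolyC j x / (Nat.factorial j : ℂ)

theorem bernDiv_zero (x : ℂ) : bernDiv 0 x = 1 := by
  simp [bernDiv, BpolyC]

theorem hasDerivAt_bernDiv_succ (j : ℕ) (x : ℂ) :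
    HasDerivAt (bernDiv (j + 1)) (bernDiv j x) x := by
  have h := ((Polynomial.bernoulli (j + 1)).hasDerivAt_aeval x).div_const
    (Nat.factorial (j + 1) : ℂ)
  refine h.congr_deriv ?_
  rw [Polynomial.derivative_bernoulli_add_one, bernDiv, BpolyC, Nat.factorial_succ]
  have h1 : (Nat.factorial j : ℂ) ≠ 0 := by exact_mod_cast Nat.factorial_ne_zero j
  have h2 : (j : ℂ) + 1 ≠ 0 := Nat.cast_add_one_ne_zero j
  simp only [map_mul, map_add, map_natCast, map_one]
  push_cast
  field_simp

theorem hasDerivAt_bernDiv_zero (x : ℂ) : HasDerivAt (bernDiv 0) 0 x := by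
  rw [funext bernDiv_zero]
  exact hasDerivAt_const x 1

theorem continuous_bernDiv (j : ℕ) : Continuous (bernDiv j) := by
  unfold bernDiv BpolyC
  exact ((Polynomial.bernoulli j).continuous_aeval).div_const _

theorem bernDiv_one_sub_zero (j : ℕ) :
    bernDiv j 1 - bernDiv j 0 = if j = 1 then 1 else 0 := by
  have h := Polynomial.bernoulli_eval_one_add j 0
  have e1 : BpolyC j 1 = ((Polynomial.eval (1 : ℚ) (Polynomial.bernoulli j) : ℚ) : ℂ) := by
    rw [BpolyC, ← map_one (algebraMap ℚ ℂ), Polynomial.aeval_algebraMap_apply]; simp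
  have e0 : BpolyC j 0 = ((Polynomial.eval (0 : ℚ) (Polynomial.bernoulli j) : ℚ) : ℂ) := by
    rw [BpolyC, ← map_zero (algebraMap ℚ ℂ), Polynomial.aeval_algebraMap_apply]; simp
  rw [bernDiv, bernDiv, e1, e0, ← sub_div, ← Rat.cast_sub]
  rw [add_zero] at h
  rw [h, add_sub_cancel_left]
  split_ifs with h1
  · subst h1; simp
  · rcases j with _ | j
    · simp
    · rw [Nat.add_sub_cancel, zero_pow (by lia)]; simp

/-- The Bernoulli polynomial term of the transformation formula. -/
def bernSum (k : ℤ) (t a b : ℂ) : ℂ :=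
  (-2 * (π : ℂ)) ^ k * ∑ j ∈ Finset.range (k + 2).toNat,
    (-I) ^ j * bernDiv j a * bernDiv ((k + 1).toNat - j) b * t ^ (k - (j : ℤ))

theorem bernSum_of_lt {k : ℤ} (hk : k < -1) (t a b : ℂ) : bernSum k t a b = 0 := by
  rw [bernSum, show (k + 2).toNat = 0 by lia]; simp

theorem bernSum_neg_one (t a b : ℂ) : bernSum (-1) t a b = (-2 * (π : ℂ))⁻¹ * t⁻¹ := by
  simp [bernSum, bernDiv_zero]

theorem bernSum_natCast (M : ℕ) (t a b : ℂ) :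
    bernSum M t a b = (-2 * (π : ℂ)) ^ M * ∑ j ∈ Finset.range (M + 2),
      (-I) ^ j * bernDiv j a * bernDiv (M + 1 - j) b * t ^ ((M : ℤ) - (j : ℤ)) := by
  rw [bernSum, show ((M : ℤ) + 2).toNat = M + 2 by lia, show ((M : ℤ) + 1).toNat = M + 1 by lia,
    zpow_natCast]

theorem bernSum_natCast_sub_one (M : ℕ) (t a b : ℂ) :
    bernSum (M - 1) t a b = (-2 * (π : ℂ)) ^ ((M : ℤ) - 1) * ∑ j ∈ Finset.range (M + 1),
      (-I) ^ j * bernDiv j a * bernDiv (M - j) b * t ^ ((M : ℤ) - 1 - (j : ℤ)) := by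
  rw [bernSum, show ((M : ℤ) - 1 + 2).toNat = M + 1 by lia,
    show ((M : ℤ) - 1 + 1).toNat = M by lia]

theorem neg_two_pi_ne_zero : (-2 * (π : ℂ)) ≠ 0 := by
  simp [Real.pi_ne_zero]

theorem hasDerivAt_bernSum_left (k : ℤ) {t : ℂ} (a b : ℂ) :
    HasDerivAt (fun a => bernSum k t a b) (2 * π * I * bernSum (k - 1) t a b) a := by
  rcases lt_or_ge k 0 with hk | hk
  · rw [bernSum_of_lt (k := k - 1) (by lia), mul_zero]
    rcases eq_or_ne k (-1) with rfl | h1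
    · simp_rw [bernSum_neg_one]
      exact hasDerivAt_const _ _
    · simp_rw [bernSum_of_lt (k := k) (by lia)]
      exact hasDerivAt_const _ _
  · lift k to ℕ using hk
    simp_rw [bernSum_natCast, bernSum_natCast_sub_one]
    have hj : ∀ j ∈ Finset.range (k + 2), HasDerivAt
        (fun a => (-I) ^ j * bernDiv j a * bernDiv (k + 1 - j) b * t ^ ((k : ℤ) - (j : ℤ)))
        ((-I) ^ j * (if j = 0 then 0 else bernDiv (j - 1) a) * bernDiv (k + 1 - j) b *
          t ^ ((k : ℤ) - (j : ℤ))) a := by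
      intro j _
      refine HasDerivAt.mul_const (HasDerivAt.mul_const (HasDerivAt.const_mul _ ?_) _) _
      rcases j with _ | j
      · simpa using hasDerivAt_bernDiv_zero a
      · simpa using hasDerivAt_bernDiv_succ j a
    refine ((HasDerivAt.fun_sum hj).const_mul _).congr_deriv ?_
    rw [Finset.sum_range_succ', Finset.mul_sum, Finset.mul_sum, mul_add, Finset.mul_sum]
    simp only [if_true, mul_zero, zero_mul, add_zero]
    refine Finset.sum_congr rfl fun j _ => ?_
    rw [if_neg (by lia), Nat.add_sub_cancel, Nat.add_sub_add_right, zpow_sub_one₀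
      neg_two_pi_ne_zero, zpow_natCast, pow_succ (-I) j,
      show (k : ℤ) - ((j + 1 : ℕ) : ℤ) = k - 1 - j by push_cast; ring]
    have := neg_two_pi_ne_zero
    field_simp

theorem hasDerivAt_bernSum_right (k : ℤ) {t : ℂ} (ht : t ≠ 0) (a b : ℂ) :
    HasDerivAt (fun b => bernSum k t a b) (-2 * π * t * bernSum (k - 1) t a b) b := by
  rcases lt_or_ge k 0 with hk | hk
  · rw [bernSum_of_lt (k := k - 1) (by lia), mul_zero]
    rcases eq_or_ne k (-1) with rfl | h1
    · simp_rw [bernSum_neg_one]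
      exact hasDerivAt_const _ _
    · simp_rw [bernSum_of_lt (k := k) (by lia)]
      exact hasDerivAt_const _ _
  · lift k to ℕ using hk
    simp_rw [bernSum_natCast, bernSum_natCast_sub_one]
    have hj : ∀ j ∈ Finset.range (k + 2), HasDerivAt
        (fun b => (-I) ^ j * bernDiv j a * bernDiv (k + 1 - j) b * t ^ ((k : ℤ) - (j : ℤ)))
        ((-I) ^ j * bernDiv j a * (if j = k + 1 then 0 else bernDiv (k - j) b) *
          t ^ ((k : ℤ) - (j : ℤ))) b := by
      intro j hj
      rw [Finset.mem_range] at hj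
      refine HasDerivAt.mul_const (HasDerivAt.const_mul _ ?_) _
      split_ifs with h
      · subst h
        simpa using hasDerivAt_bernDiv_zero b
      · rw [show k + 1 - j = (k - j) + 1 by lia]
        exact hasDerivAt_bernDiv_succ (k - j) b
    refine ((HasDerivAt.fun_sum hj).const_mul _).congr_deriv ?_
    rw [Finset.sum_range_succ, Finset.mul_sum, mul_add, Finset.mul_sum, Finset.mul_sum]
    simp only [if_true, mul_zero, zero_mul, add_zero]
    refine Finset.sum_congr rfl fun j hj => ?_
    rw [Finset.mem_range] at hj
    rw [if_neg (by lia), zpow_sub_one₀ neg_two_pi_ne_zero, zpow_natCast,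
      show (k : ℤ) - 1 - j = k - j - 1 by ring, zpow_sub_one₀ ht]
    have := neg_two_pi_ne_zero
    field_simp

theorem continuous_bernSum (k : ℤ) (t : ℂ) :
    Continuous fun p : ℂ × ℂ => bernSum k t p.1 p.2 := by
  unfold bernSum
  have := continuous_bernDiv
  fun_prop

theorem bernSum_one_sub_zero_left (M : ℕ) (t b : ℂ) :
    bernSum M t 1 b - bernSum M t 0 b =
      (-2 * (π : ℂ)) ^ M * (-I * bernDiv M b * t ^ ((M : ℤ) - 1)) := by
  rw [bernSum_natCast, bernSum_natCast, ← mul_sub, ← Finset.sum_sub_distrib,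
    Finset.sum_eq_single 1]
  · have := bernDiv_one_sub_zero 1
    simp only [if_true] at this
    rw [Nat.add_sub_cancel, eq_add_of_sub_eq this]
    push_cast; ring
  · intro j _ hj
    have := bernDiv_one_sub_zero j
    rw [if_neg hj, sub_eq_zero] at this
    rw [this, sub_self]
  · intro h; simp at h

theorem bernSum_one_sub_zero_right (M : ℕ) (t a : ℂ) :
    bernSum M t a 1 - bernSum M t a 0 = (-2 * (π : ℂ)) ^ M * ((-I) ^ M * bernDiv M a) := by
  rw [bernSum_natCast, bernSum_natCast, ← mul_sub, ← Finset.sum_sub_distrib,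
    Finset.sum_eq_single M]
  · have := bernDiv_one_sub_zero 1
    simp only [if_true] at this
    rw [Nat.add_sub_cancel_left, eq_add_of_sub_eq this]
    simp; ring
  · intro j hM hj
    rw [Finset.mem_range] at hM
    have := bernDiv_one_sub_zero (M + 1 - j)
    rw [if_neg (by lia), sub_eq_zero] at this
    rw [this, sub_self]
  · intro h; simp at h

theorem bernDiv_eq_bernoulliFun (k : ℕ) (x : ℝ) :
    bernDiv k x = (bernoulliFun k x : ℂ) / (Nat.factorial k : ℂ) := by
  rw [bernDiv, BpolyC, bernoulliFun, Polynomial.eval_map_algebraMap,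
    Polynomial.aeval_def, Polynomial.aeval_def, ← Complex.coe_algebraMap, Polynomial.hom_eval₂]
  congr 2

theorem expSeries_li_bernoulli {k : ℕ} (hk : 2 ≤ k) {x : ℝ} (hx : x ∈ Set.Icc (0 : ℝ) 1) :
    expSeries (liCoeff k) (-(2 * π * I * x)) + (-1) ^ k * expSeries (liCoeff k) (2 * π * I * x) =
      -(2 * π * I) ^ k * bernDiv k x := by
  have h := hasSum_one_div_nat_pow_mul_fourier hk hx
  rw [← hasSum_nat_add_iff' 1] at h
  have h0 : ∀ w : ℂ, w.re = 0 → Summable fun n : ℕ =>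
      liCoeff k n * Complex.exp (-(((n : ℂ) + 1) * w)) := fun w hw =>
    summable_expSeries_of_nonneg (powBound_liCoeff k) (by lia) hw.ge
  have hs1 := (h0 (-(2 * π * I * x)) (by simp)).hasSum
  have hs2 := (h0 (2 * π * I * x) (by simp)).hasSum
  have h3 := hs1.add (hs2.mul_left ((-1 : ℂ) ^ k))
  rw [expSeries, expSeries, bernDiv_eq_bernoulliFun]
  refine h3.unique ?_
  have hf : (fun n : ℕ => liCoeff k n * Complex.exp (-(((n : ℂ) + 1) * -(2 * π * I * x))) +
      (-1) ^ k * (liCoeff k n * Complex.exp (-(((n : ℂ) + 1) * (2 * π * I * x))))) =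
      fun n : ℕ => 1 / ((n + 1 : ℕ) : ℂ) ^ k * (fourier ((n + 1 : ℕ) : ℤ) (x : UnitAddCircle) +
        (-1) ^ k * fourier (-((n + 1 : ℕ) : ℤ)) (x : UnitAddCircle)) := by
    funext n
    rw [fourier_coe_apply, fourier_coe_apply, liCoeff, zpow_neg, zpow_natCast]
    push_cast
    rw [one_div, mul_add, mul_left_comm]
    congr 2
    · congr 1; ring
    · congr 2; ring
  rw [hf]
  have hk0 : (k : ℕ) ≠ 0 := by lia
  have hv : -(2 * π * I) ^ k / (Nat.factorial k : ℂ) * (bernoulliFun k x : ℂ) -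
      ∑ i ∈ Finset.range 1, 1 / ((i : ℕ) : ℂ) ^ k * (fourier (i : ℤ) (x : UnitAddCircle) +
        (-1) ^ k * fourier (-(i : ℤ)) (x : UnitAddCircle)) =
      -(2 * π * I) ^ k * ((bernoulliFun k x : ℂ) / (Nat.factorial k : ℂ)) := by
    simp [hk0]
    ring
  rw [← hv]
  exact h

end

/-- The symmetrized Lambert series. -/
def lambertV (k : ℤ) (t w : ℂ) : ℂ :=
  lambertU k t w + (-1) ^ (k - 1) * lambertU k t (2 * π * t - w)

theorem hasDerivAt_lambertV (k : ℤ) {t w : ℂ} (ht : 0 < t.re) (hw : 0 < w.re)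
    (hw' : w.re < 2 * π * t.re) :
    HasDerivAt (lambertV k t) (-lambertV (k - 1) t w) w := by
  have h1 := hasDerivAt_lambertU k ht hw
  have h2 : 0 < (2 * π * t - w).re := by
    rw [Complex.sub_re, re_two_pi_mul]; linarith
  have h3 := (hasDerivAt_lambertU k ht h2).comp w ((hasDerivAt_id w).const_sub (2 * π * t))
  refine (h1.add (h3.const_mul ((-1) ^ (k - 1)))).congr_deriv ?_
  rw [lambertV, zpow_sub_one₀ (by norm_num) (k - 1)]
  ring

theorem lambertU_add_two_pi_I (k : ℤ) (t w : ℂ) :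
    lambertU k t (w + 2 * π * I) = lambertU k t w := expSeries_add_two_pi_I _ _

theorem lambertU_sub_two_pi_I (k : ℤ) (t w : ℂ) :
    lambertU k t (w - 2 * π * I) = lambertU k t w := expSeries_sub_two_pi_I _ _

theorem lambertV_add_two_pi_I (k : ℤ) (t w : ℂ) :
    lambertV k t (w + 2 * π * I) = lambertV k t w := by
  rw [lambertV, lambertU_add_two_pi_I, ← sub_sub, lambertU_sub_two_pi_I, lambertV]

theorem lambertV_shift {k : ℤ} (hk : 2 ≤ k) {t w : ℂ} (ht : 0 < t.re) (hw : w.re = 0) :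
    lambertV k t (w + 2 * π * t) - lambertV k t w =
      -(expSeries (liCoeff k) w + (-1) ^ k * expSeries (liCoeff k) (-w)) := by
  have h1 := lambertU_sub_shift k ht (w := w) (Or.inr ⟨hk, hw.ge⟩)
  have h2 := lambertU_sub_shift k ht (w := -w) (Or.inr ⟨hk, by simp [hw]⟩)
  rw [lambertV, lambertV, show 2 * π * t - (w + 2 * π * t) = -w by ring,
    show 2 * π * t - w = -w + 2 * π * t by ring, h1, h2, zpow_sub_one₀ (by norm_num)]
  ring

theorem continuousOn_lambertV {k : ℤ} (hk : 2 ≤ k) {t : ℂ} (ht : 0 < t.re) :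
    ContinuousOn (lambertV k t) {w | 0 ≤ w.re ∧ w.re ≤ 2 * π * t.re} := by
  have h := continuousOn_expSeries (powBound_lambertCoeff k ht) (by lia)
  refine (h.mono fun w hw => hw.1).add (continuousOn_const.mul
    (h.comp (f := fun w => 2 * π * t - w) (by fun_prop) fun w hw => ?_))
  simp only [Set.mem_ofPred_eq] at hw ⊢
  rw [Complex.sub_re, re_two_pi_mul]; linarith [hw.2]

theorem inv_re_pos {t : ℂ} (ht : 0 < t.re) : 0 < t⁻¹.re := by
  rw [Complex.inv_re]
  exact div_pos ht (Complex.normSq_pos.mpr fun h => by simp [h] at ht)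

/-- The defect in the transformation formula on the open unit square. -/
def lambertDefect (k : ℤ) (t : ℂ) (a b : ℝ) : ℂ :=
  lambertV k t (2 * π * (t * b - I * a)) - bernSum k t a b -
    (-I * t) ^ (k - 1) * lambertV k t⁻¹ (2 * π * (t⁻¹ * a + I * b))

theorem re_left_arg (t : ℂ) (a b : ℝ) :
    (2 * π * (t * b - I * a) : ℂ).re = 2 * π * t.re * b := by
  simp; ring

theorem re_right_arg (t : ℂ) (a b : ℝ) :
    (2 * π * (t * a + I * b) : ℂ).re = 2 * π * t.re * a := by
  simp; ring

theorem neg_I_mul_ne_zero {t : ℂ} (ht : 0 < t.re) : -I * t ≠ 0 :=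
  mul_ne_zero (neg_ne_zero.mpr I_ne_zero) (ne_zero_of_re_pos ht)

theorem hasDerivAt_lambertDefect_left (k : ℤ) {t : ℂ} (ht : 0 < t.re) {a b : ℝ}
    (ha : a ∈ Set.Ioo (0 : ℝ) 1) (hb : b ∈ Set.Ioo (0 : ℝ) 1) :
    HasDerivAt (fun a => lambertDefect k t a b) (2 * π * I * lambertDefect (k - 1) t a b) a := by
  have ht0 := ne_zero_of_re_pos ht
  have hp : 0 < 2 * π * t.re := by positivity
  have hp' : 0 < 2 * π * t⁻¹.re := by have := inv_re_pos ht; positivity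
  have h1 := (hasDerivAt_lambertV k ht (w := 2 * π * (t * b - I * a))
    (by rw [re_left_arg]; exact mul_pos hp hb.1)
    (by rw [re_left_arg]; exact mul_lt_of_lt_one_right hp hb.2)).comp (a : ℂ)
    ((((hasDerivAt_id (a : ℂ)).const_mul I).const_sub (t * b)).const_mul (2 * π : ℂ))
  have h2 := (hasDerivAt_lambertV k (inv_re_pos ht) (w := 2 * π * (t⁻¹ * a + I * b))
    (by rw [re_right_arg]; exact mul_pos hp' ha.1)
    (by rw [re_right_arg]; exact mul_lt_of_lt_one_right hp' ha.2)).comp (a : ℂ)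
    ((((hasDerivAt_id (a : ℂ)).const_mul t⁻¹).add_const (I * b)).const_mul (2 * π : ℂ))
  have h3 := ((h1.sub (hasDerivAt_bernSum_left k (t := t) a b)).sub
    (h2.const_mul ((-I * t) ^ (k - 1)))).comp_ofReal
  refine h3.congr_deriv ?_
  rw [lambertDefect, zpow_sub_one₀ (neg_I_mul_ne_zero ht) (k - 1)]
  field_simp

theorem hasDerivAt_lambertDefect_right (k : ℤ) {t : ℂ} (ht : 0 < t.re) {a b : ℝ}
    (ha : a ∈ Set.Ioo (0 : ℝ) 1) (hb : b ∈ Set.Ioo (0 : ℝ) 1) :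
    HasDerivAt (fun b => lambertDefect k t a b) (-2 * π * t * lambertDefect (k - 1) t a b) b := by
  have ht0 := ne_zero_of_re_pos ht
  have hp : 0 < 2 * π * t.re := by positivity
  have hp' : 0 < 2 * π * t⁻¹.re := by have := inv_re_pos ht; positivity
  have h1 := (hasDerivAt_lambertV k ht (w := 2 * π * (t * b - I * a))
    (by rw [re_left_arg]; exact mul_pos hp hb.1)
    (by rw [re_left_arg]; exact mul_lt_of_lt_one_right hp hb.2)).comp (b : ℂ)
    ((((hasDerivAt_id (b : ℂ)).const_mul t).sub_const (I * a)).const_mul (2 * π : ℂ))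
  have h2 := (hasDerivAt_lambertV k (inv_re_pos ht) (w := 2 * π * (t⁻¹ * a + I * b))
    (by rw [re_right_arg]; exact mul_pos hp' ha.1)
    (by rw [re_right_arg]; exact mul_lt_of_lt_one_right hp' ha.2)).comp (b : ℂ)
    ((((hasDerivAt_id (b : ℂ)).const_mul I).const_add (t⁻¹ * a)).const_mul (2 * π : ℂ))
  have h3 := ((h1.sub (hasDerivAt_bernSum_right k ht0 a b)).sub
    (h2.const_mul ((-I * t) ^ (k - 1)))).comp_ofReal
  refine h3.congr_deriv ?_
  rw [lambertDefect, zpow_sub_one₀ (neg_I_mul_ne_zero ht) (k - 1)]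
  generalize lambertV (k - 1) t⁻¹ (2 * π * (t⁻¹ * a + I * b)) = v
  field_simp
  linear_combination (-(t * I)) ^ (k - 1) * v * I_sq

theorem continuousOn_lambertDefect {k : ℤ} (hk : 2 ≤ k) {t : ℂ} (ht : 0 < t.re) :
    ContinuousOn (fun p : ℝ × ℝ => lambertDefect k t p.1 p.2)
      (Set.Icc (0 : ℝ) 1 ×ˢ Set.Icc (0 : ℝ) 1) := by
  have hp : 0 < 2 * π * t.re := by positivity
  have hp' : 0 < 2 * π * t⁻¹.re := by have := inv_re_pos ht; positivity
  unfold lambertDefect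
  refine (ContinuousOn.sub ?_ ?_).sub (continuousOn_const.mul ?_)
  · refine (continuousOn_lambertV hk ht).comp (by fun_prop) fun p hp => ?_
    simp only [Set.mem_ofPred_eq]
    rw [re_left_arg]
    exact ⟨mul_nonneg (by positivity) hp.2.1, mul_le_of_le_one_right (by positivity) hp.2.2⟩
  · exact ((continuous_bernSum k t).comp (f := fun p : ℝ × ℝ => ((p.1 : ℂ), (p.2 : ℂ)))
      (by fun_prop)).continuousOn
  · refine (continuousOn_lambertV hk (inv_re_pos ht)).comp (by fun_prop) fun p hp => ?_
    simp only [Set.mem_ofPred_eq]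
    rw [re_right_arg]
    exact ⟨mul_nonneg (by positivity) hp.1.1, mul_le_of_le_one_right (by positivity) hp.1.2⟩

theorem lambertDefect_one_left {k : ℕ} (hk : 2 ≤ k) {t : ℂ} (ht : 0 < t.re) {b : ℝ}
    (hb : b ∈ Set.Icc (0 : ℝ) 1) : lambertDefect k t 1 b = lambertDefect k t 0 b := by
  have ht0 := ne_zero_of_re_pos ht
  have h1 := bernSum_one_sub_zero_left k t b
  have h2 := lambertV_shift (k := k) (by lia) (inv_re_pos ht) (w := 2 * π * I * b) (by simp)
  have h3 := expSeries_li_bernoulli hk hb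
  have h4 := lambertV_add_two_pi_I k t (2 * π * (t * b - I))
  have hs : ((-1 : ℂ) ^ k) * (-1) ^ k = 1 := by rw [← mul_pow]; simp
  have hLi : expSeries (liCoeff k) (2 * π * I * b) +
      (-1) ^ (k : ℤ) * expSeries (liCoeff k) (-(2 * π * I * b)) =
      (-1) ^ k * (-(2 * π * I) ^ k * bernDiv k b) := by
    rw [← h3, zpow_natCast, mul_add, ← mul_assoc, hs, one_mul, add_comm]
  have hpow : (-I * t) ^ ((k : ℤ) - 1) * ((-1) ^ k * (2 * π * I) ^ k) =
      (-2 * (π : ℂ)) ^ k * (I * t ^ ((k : ℤ) - 1)) := by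
    obtain ⟨n, rfl⟩ : ∃ n, k = n + 1 := ⟨k - 1, by lia⟩
    have hI : (-I) ^ n * I ^ n = 1 := by rw [← mul_pow]; simp
    rw [show ((n + 1 : ℕ) : ℤ) - 1 = n by push_cast; ring, zpow_natCast, zpow_natCast,
      ← mul_pow, mul_pow (-I) t, show (-1 * (2 * π * I) : ℂ) = (-2 * π) * I by ring,
      mul_pow _ I, pow_succ I]
    linear_combination (-2 * (π : ℂ)) ^ (n + 1) * t ^ n * I * hI
  rw [hLi] at h2
  rw [lambertDefect, lambertDefect]
  push_cast
  rw [show 2 * π * (t * b - I * 1) = 2 * π * (t * b - I) by ring,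
    show 2 * π * (t * b - I * 0) = 2 * π * (t * b - I) + 2 * π * I by ring, h4,
    show 2 * π * (t⁻¹ * 1 + I * b) = 2 * π * I * b + 2 * π * t⁻¹ by ring,
    show 2 * π * (t⁻¹ * 0 + I * b) = 2 * π * I * b by ring,
    eq_add_of_sub_eq h1, eq_add_of_sub_eq h2]
  linear_combination -bernDiv k b * hpow

theorem lambertDefect_one_right {k : ℕ} (hk : 2 ≤ k) {t : ℂ} (ht : 0 < t.re) {a : ℝ}
    (ha : a ∈ Set.Icc (0 : ℝ) 1) : lambertDefect k t a 1 = lambertDefect k t a 0 := by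
  have h1 := bernSum_one_sub_zero_right k t a
  have h2 := lambertV_shift (k := k) (by lia) ht (w := -(2 * π * I * a)) (by simp)
  have h3 := expSeries_li_bernoulli hk ha
  have h4 := lambertV_add_two_pi_I k t⁻¹ (2 * π * (t⁻¹ * a))
  rw [neg_neg, zpow_natCast, h3] at h2
  have h5 : (-2 * (π : ℂ)) ^ k * ((-I) ^ k * bernDiv k a) =
      (2 * π * I) ^ k * bernDiv k a := by
    rw [← mul_assoc, ← mul_pow]; ring
  rw [h5] at h1
  rw [lambertDefect, lambertDefect]
  push_cast
  rw [show 2 * π * (t⁻¹ * a + I * 1) = 2 * π * (t⁻¹ * a) + 2 * π * I by ring, h4,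
    show 2 * π * (t * 1 - I * a) = -(2 * π * I * a) + 2 * π * t by ring,
    show 2 * π * (t * 0 - I * a) = -(2 * π * I * a) by ring,
    show 2 * π * (t⁻¹ * a + I * 0) = 2 * π * (t⁻¹ * a) by ring,
    eq_add_of_sub_eq h1, eq_add_of_sub_eq h2]
  ring

theorem eq_of_fourierIntegral_eq_zero {F : ℝ → ℂ} (hc : ContinuousOn F (Set.Icc 0 1))
    (h01 : F 1 = F 0)
    (hF : ∀ l : ℤ, l ≠ 0 → ∫ x in (0 : ℝ)..1, F x * Complex.exp (-(2 * π * I * l * x)) = 0)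
    {x y : ℝ} (hx : x ∈ Set.Ico (0 : ℝ) 1) (hy : y ∈ Set.Ico (0 : ℝ) 1) : F x = F y := by
  have hcont : Continuous (AddCircle.liftIco (1 : ℝ) 0 F) :=
    AddCircle.liftIco_continuous (by simpa using h01.symm) (by simpa using hc)
  let f : C(AddCircle (1 : ℝ), ℂ) := ⟨_, hcont⟩
  have hcoef : ∀ l : ℤ, l ≠ 0 → fourierCoeff f l = 0 := by
    intro l hl
    rw [fourierCoeff_eq_intervalIntegral _ _ 0]
    rw [one_div_one, one_smul, zero_add, ← hF l hl]
    refine intervalIntegral.integral_congr_Ioo_of_le zero_le_one fun z hz => ?_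
    have : f (z : AddCircle (1 : ℝ)) = F z :=
      AddCircle.liftIco_zero_coe_apply (Set.Ioo_subset_Ico_self hz)
    simp only [this, fourier_coe_apply, smul_eq_mul]
    rw [mul_comm]
    congr 2
    push_cast
    ring
  have hs : Summable (fourierCoeff f) :=
    summable_of_ne_finset_zero (s := {0}) fun l hl => hcoef l (by simpa using hl)
  have key : ∀ z ∈ Set.Ico (0 : ℝ) 1, F z = fourierCoeff f 0 := by
    intro z hz
    have h := has_pointwise_sum_fourier_series_of_summable hs (z : AddCircle (1 : ℝ))
    have h2 := hasSum_single (f := fun i => fourierCoeff f i • fourier i (z : AddCircle (1 : ℝ))) 0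
      fun l hl => by simp [hcoef l hl]
    have h3 : f (z : AddCircle (1 : ℝ)) = F z := AddCircle.liftIco_zero_coe_apply hz
    rw [← h3, h.unique h2]
    simp
  rw [key x hx, key y hy]

theorem integral_fourier_eq_zero_of_transport {F G : ℝ → ℝ → ℂ} {t : ℂ} (ht : 0 < t.re)
    (hFc : ContinuousOn (fun p : ℝ × ℝ => F p.1 p.2) (Set.Icc (0 : ℝ) 1 ×ˢ Set.Icc (0 : ℝ) 1))
    (hGc : ContinuousOn (fun p : ℝ × ℝ => G p.1 p.2) (Set.Icc (0 : ℝ) 1 ×ˢ Set.Icc (0 : ℝ) 1))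
    (hleft : ∀ b ∈ Set.Icc (0 : ℝ) 1, F 1 b = F 0 b)
    (hright : ∀ a ∈ Set.Icc (0 : ℝ) 1, F a 1 = F a 0)
    (hda : ∀ a ∈ Set.Ioo (0 : ℝ) 1, ∀ b ∈ Set.Ioo (0 : ℝ) 1,
      HasDerivAt (fun a => F a b) (2 * π * I * G a b) a)
    (hdb : ∀ a ∈ Set.Ioo (0 : ℝ) 1, ∀ b ∈ Set.Ioo (0 : ℝ) 1,
      HasDerivAt (fun b => F a b) (-2 * π * t * G a b) b)
    {l : ℤ} (hl : l ≠ 0) {b : ℝ} (hb : b ∈ Set.Icc (0 : ℝ) 1) :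
    ∫ a in (0 : ℝ)..1, F a b * Complex.exp (-(2 * π * I * l * a)) = 0 := by
  set ex : ℝ → ℂ := fun a => Complex.exp (-(2 * π * I * l * a)) with hex
  have hexc : Continuous ex := by fun_prop
  set C : ℝ → ℂ := fun b => ∫ a in (0 : ℝ)..1, F a b * ex a with hC
  have hslice : ∀ {H : ℝ → ℝ → ℂ},
      ContinuousOn (fun p : ℝ × ℝ => H p.1 p.2) (Set.Icc (0 : ℝ) 1 ×ˢ Set.Icc (0 : ℝ) 1) →
      ∀ b ∈ Set.Icc (0 : ℝ) 1, ContinuousOn (fun a => H a b) (Set.Icc 0 1) := by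
    intro H hH b hb
    exact hH.comp (f := fun a : ℝ => (a, b)) (by fun_prop) fun a ha => ⟨ha, hb⟩
  have h_int : ∀ {H : ℝ → ℝ → ℂ},
      ContinuousOn (fun p : ℝ × ℝ => H p.1 p.2) (Set.Icc (0 : ℝ) 1 ×ˢ Set.Icc (0 : ℝ) 1) →
      ∀ b ∈ Set.Icc (0 : ℝ) 1,
        IntervalIntegrable (fun a => H a b * ex a) volume 0 1 := by
    intro H hH b hb
    refine ContinuousOn.intervalIntegrable ?_
    rw [Set.uIcc_of_le zero_le_one]
    exact (hslice hH b hb).mul hexc.continuousOn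
  have hCc : ContinuousOn C (Set.Icc 0 1) := by
    let pr : ℝ → ℝ := fun x => (Set.projIcc (0 : ℝ) 1 zero_le_one x : ℝ)
    have hpr : Continuous pr := continuous_subtype_val.comp continuous_projIcc
    have hFt : Continuous fun p : ℝ × ℝ => F (pr p.2) (pr p.1) :=
      hFc.comp_continuous (f := fun p : ℝ × ℝ => (pr p.2, pr p.1)) (by fun_prop)
        fun p => ⟨Subtype.coe_prop _, Subtype.coe_prop _⟩
    have hCt : Continuous fun b => ∫ a in (0 : ℝ)..1, F (pr a) (pr b) * ex a := by
      refine intervalIntegral.continuous_parametric_intervalIntegral_of_continuous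
        (f := fun b a => F (pr a) (pr b) * ex a) ?_ continuous_const
      exact hFt.mul (hexc.comp continuous_snd)
    refine hCt.continuousOn.congr fun b hb => ?_
    refine intervalIntegral.integral_congr fun a ha => ?_
    rw [Set.uIcc_of_le zero_le_one] at ha
    simp only [pr]
    rw [Set.projIcc_of_mem _ ha, Set.projIcc_of_mem _ hb]
  have hparts : ∀ b ∈ Set.Ioo (0 : ℝ) 1, ∫ a in (0 : ℝ)..1, G a b * ex a = l * C b := by
    intro b hb
    have hb' := Set.Ioo_subset_Icc_self hb
    have h := intervalIntegral.integral_mul_deriv_eq_deriv_mul_of_hasDerivAt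
      (a := 0) (b := 1) (u := ex) (v := fun a => F a b)
      (u' := fun a => -(2 * π * I * l) * ex a) (v' := fun a => 2 * π * I * G a b)
      hexc.continuousOn (by rw [Set.uIcc_of_le zero_le_one]; exact hslice hFc b hb')
      (fun x _ => by
        have := ((((hasDerivAt_id (x : ℂ)).const_mul (2 * π * I * l : ℂ)).neg).cexp).comp_ofReal
        refine this.congr_deriv ?_
        simp only [hex, id, Pi.neg_apply]
        ring)
      (fun x hx => by
        rw [min_eq_left zero_le_one, max_eq_right zero_le_one] at hx
        exact hda x hx b hb)
      ((continuous_const.mul hexc).intervalIntegrable _ _)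
      (ContinuousOn.intervalIntegrable (by
        rw [Set.uIcc_of_le zero_le_one]
        exact continuousOn_const.mul (hslice hGc b hb')))
    have e1 : ex 1 = 1 := by
      simp only [hex]
      rw [show -(2 * π * I * l * ((1 : ℝ) : ℂ)) = ((-l : ℤ) : ℂ) * (2 * π * I) by push_cast; ring,
        Complex.exp_int_mul_two_pi_mul_I]
    have e0 : ex 0 = 1 := by simp [hex]
    have i1 : ∫ a in (0 : ℝ)..1, ex a * (2 * π * I * G a b) =
        2 * π * I * ∫ a in (0 : ℝ)..1, G a b * ex a := by
      rw [← intervalIntegral.integral_const_mul]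
      exact intervalIntegral.integral_congr fun a _ => by ring
    have i2 : ∫ a in (0 : ℝ)..1, -(2 * π * I * l) * ex a * F a b = -(2 * π * I * l) * C b := by
      rw [hC, ← intervalIntegral.integral_const_mul]
      exact intervalIntegral.integral_congr fun a _ => by ring
    rw [i1, i2, e1, e0, hleft b hb', sub_self, zero_sub, neg_mul, neg_neg] at h
    have := Complex.two_pi_I_ne_zero
    refine mul_left_cancel₀ this ?_
    rw [h]; ring
  have hCd : ∀ b ∈ Set.Ioo (0 : ℝ) 1, HasDerivAt C (-2 * π * t * l * C b) b := by
    intro b hb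
    obtain ⟨M, hM⟩ := (isCompact_Icc.prod isCompact_Icc).exists_bound_of_continuousOn
      ((continuousOn_const (c := (-2 * π * t : ℂ))).mul hGc)
    have h := (intervalIntegral.hasDerivAt_integral_of_dominated_loc_of_deriv_le (μ := volume)
      (a := 0) (b := 1) (F := fun b a => F a b * ex a)
      (F' := fun b a => -2 * π * t * G a b * ex a) (bound := fun _ => M)
      (Ioo_mem_nhds hb.1 hb.2)
      (Filter.eventually_of_mem (Ioo_mem_nhds hb.1 hb.2) fun x hx =>
        (intervalIntegrable_iff.mp (h_int hFc x (Set.Ioo_subset_Icc_self hx))).aestronglyMeasurable)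
      (h_int hFc b (Set.Ioo_subset_Icc_self hb))
      (by
        have := ((h_int hGc b (Set.Ioo_subset_Icc_self hb)).const_mul (-2 * π * t : ℂ))
        have := (intervalIntegrable_iff.mp this).aestronglyMeasurable
        simpa only [mul_assoc] using this)
      (Filter.Eventually.of_forall fun a ha x hx => by
        rw [Set.uIoc_of_le zero_le_one] at ha
        have h1 := hM (a, x) ⟨Set.Ioc_subset_Icc_self ha, Set.Ioo_subset_Icc_self hx⟩
        have h2 : ‖ex a‖ = 1 := by
          simp only [hex]
          rw [Complex.norm_exp]; simp
        rw [norm_mul, h2, mul_one]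
        exact h1)
      intervalIntegrable_const
      (by
        have : ∀ᵐ a : ℝ ∂volume, a ≠ 1 := by simp [ae_iff]
        filter_upwards [this] with a ha1 ha x hx
        rw [Set.uIoc_of_le zero_le_one] at ha
        exact (hdb a ⟨ha.1, lt_of_le_of_ne ha.2 ha1⟩ x hx).mul_const _)).2
    refine h.congr_deriv ?_
    have : ∫ a in (0 : ℝ)..1, -2 * π * t * G a b * ex a =
        -2 * π * t * ∫ a in (0 : ℝ)..1, G a b * ex a := by
      rw [← intervalIntegral.integral_const_mul]
      exact intervalIntegral.integral_congr fun a _ => by ring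
    rw [this, hparts b hb]; ring
  have hconst : ∀ b ∈ Set.Icc (0 : ℝ) 1, C b * Complex.exp (2 * π * t * l * b) = C 0 := by
    intro b hb
    have h := intervalIntegral.integral_eq_sub_of_hasDerivAt_of_le hb.1
      (f := fun b : ℝ => C b * Complex.exp (2 * π * t * l * b)) (f' := fun _ => 0)
      ((hCc.mono (Set.Icc_subset_Icc_right hb.2)).mul (by fun_prop))
      (fun x hx => by
        have h1 := hCd x ⟨hx.1, hx.2.trans_le hb.2⟩
        have h2 := (((hasDerivAt_id (x : ℂ)).const_mul (2 * π * t * l : ℂ)).cexp).comp_ofReal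
        refine (h1.mul h2).congr_deriv ?_
        simp only [id]
        ring)
      intervalIntegrable_const
    simp only [intervalIntegral.integral_zero] at h
    simpa using (sub_eq_zero.mp h.symm)
  have hC1 : C 1 = C 0 := intervalIntegral.integral_congr fun a ha => by
    rw [Set.uIcc_of_le zero_le_one] at ha
    simp only [hright a ha]
  have hne : Complex.exp (2 * π * t * l * ((1 : ℝ) : ℂ)) ≠ 1 := by
    intro h
    have := congrArg norm h
    rw [Complex.norm_exp, norm_one, Real.exp_eq_one_iff] at this
    simp at this
    rcases this with h | h
    · exact ht.ne' h
    · exact hl h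
  have hC0 : C 0 = 0 := by
    have h := hconst 1 ⟨zero_le_one, le_rfl⟩
    rw [hC1] at h
    by_contra h0
    exact hne (mul_left_cancel₀ h0 (by rw [h, mul_one]))
  have h := hconst b hb
  rw [hC0] at h
  exact (mul_eq_zero.mp h).resolve_right (Complex.exp_ne_zero _)

theorem lambertDefect_eq_zero (k : ℤ) {t : ℂ} (ht : 0 < t.re) {a b : ℝ}
    (ha : a ∈ Set.Ioo (0 : ℝ) 1) (hb : b ∈ Set.Ioo (0 : ℝ) 1) : lambertDefect k t a b = 0 := by
  have hpred : ∀ k : ℤ, (∃ c : ℝ → ℂ, ∀ b ∈ Set.Ioo (0 : ℝ) 1, ∀ a ∈ Set.Ioo (0 : ℝ) 1,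
      lambertDefect k t a b = c b) → ∀ b ∈ Set.Ioo (0 : ℝ) 1, ∀ a ∈ Set.Ioo (0 : ℝ) 1,
        lambertDefect (k - 1) t a b = 0 := by
    rintro k ⟨c, hc⟩ b hb a ha
    have h1 := hasDerivAt_lambertDefect_left k ht ha hb
    have h2 : HasDerivAt (fun a => lambertDefect k t a b) 0 a :=
      (hasDerivAt_const a (c b)).congr_of_eventuallyEq
        (Filter.eventually_of_mem (Ioo_mem_nhds ha.1 ha.2) fun x hx => hc b hb x hx)
    exact (mul_eq_zero.mp (h1.unique h2)).resolve_left Complex.two_pi_I_ne_zero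
  have hbase : ∀ k : ℕ, 3 ≤ k → ∀ b ∈ Set.Ioo (0 : ℝ) 1, ∀ a ∈ Set.Ioo (0 : ℝ) 1,
      lambertDefect (k - 1) t a b = 0 := by
    intro k hk
    refine hpred k ⟨fun b => lambertDefect k t 0 b, fun b hb a ha => ?_⟩
    have hb' := Set.Ioo_subset_Icc_self hb
    have hcont := continuousOn_lambertDefect (k := k) (by lia) ht
    refine eq_of_fourierIntegral_eq_zero (F := fun a => lambertDefect k t a b)
      (hcont.comp (f := fun a : ℝ => (a, b)) (by fun_prop) fun a ha => ⟨ha, hb'⟩)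
      (lambertDefect_one_left (by lia) ht hb') (fun l hl => ?_)
      (Set.Ioo_subset_Ico_self ha) ⟨le_rfl, zero_lt_one⟩
    exact integral_fourier_eq_zero_of_transport ht hcont
      (continuousOn_lambertDefect (k := k - 1) (by lia) ht)
      (fun b hb => lambertDefect_one_left (by lia) ht hb)
      (fun a ha => lambertDefect_one_right (by lia) ht ha)
      (fun a ha b hb => hasDerivAt_lambertDefect_left k ht ha hb)
      (fun a ha b hb => hasDerivAt_lambertDefect_right k ht ha hb) hl hb'
  have hall : ∀ n : ℕ, ∀ k : ℤ, k + n ≥ 2 → ∀ b ∈ Set.Ioo (0 : ℝ) 1, ∀ a ∈ Set.Ioo (0 : ℝ) 1,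
      lambertDefect k t a b = 0 := by
    intro n
    induction n with
    | zero =>
      intro k hk
      have := hbase (k + 1).toNat (by lia)
      rwa [show (((k + 1).toNat : ℕ) : ℤ) - 1 = k by lia] at this
    | succ n ih =>
      intro k hk
      have := hpred (k + 1) ⟨fun _ => 0, ih (k + 1) (by push_cast at hk; lia)⟩
      rwa [add_sub_cancel_right] at this
  exact hall (2 - k).toNat k (by lia) b hb a ha

section

open Filter Topology

theorem exists_norm_expSeries_le {c : ℕ → ℂ} {m : ℤ} (h : PowBound c m) {r : ℝ} (hr : 0 < r) :
    ∃ B : ℝ, ∀ w : ℂ, r ≤ w.re → ‖expSeries c w‖ ≤ B * Real.exp (-(w.re - r)) := by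
  obtain ⟨C, hC⟩ := h
  have hC0 : 0 ≤ C := by have := (norm_nonneg _).trans (hC 0); simpa using this
  have hs := (summable_natSucc_zpow_mul_exp m hr).mul_left C
  refine ⟨∑' n : ℕ, C * (((n : ℝ) + 1) ^ m * Real.exp (-(((n : ℝ) + 1) * r))), fun w hw => ?_⟩
  refine tsum_of_norm_bounded (hs.hasSum.mul_right _) fun n => ?_
  refine (norm_expSeries_term_le hC le_rfl n).trans ?_
  rw [mul_assoc, mul_assoc]
  gcongr
  rw [← Real.exp_add, Real.exp_le_exp]
  nlinarith [n.cast_nonneg (α := ℝ)]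

theorem hasSum_expSeries_liCoeff_shift (k : ℤ) {t w : ℂ} (ht : 0 < t.re) (hw : 0 < w.re) :
    HasSum (fun m : ℕ => expSeries (liCoeff k) (w + 2 * π * t * m)) (lambertU k t w) := by
  have hp : 0 < 2 * π * t.re := by positivity
  have hre : ∀ m : ℕ, (w + 2 * π * t * m).re = w.re + 2 * π * t.re * m := fun m => by simp
  have hge : ∀ m : ℕ, w.re ≤ (w + 2 * π * t * m).re := fun m => by
    rw [hre]; nlinarith [m.cast_nonneg (α := ℝ)]
  have hgeom : Summable fun m : ℕ => Real.exp (-((w + 2 * π * t * m).re - w.re)) := by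
    refine (Real.summable_exp_nat_mul_iff.mpr (neg_neg_of_pos hp)).congr fun m => ?_
    rw [hre]; congr 1; ring
  have hsum : Summable fun m : ℕ => expSeries (liCoeff k) (w + 2 * π * t * m) := by
    obtain ⟨B, hB⟩ := exists_norm_expSeries_le (powBound_liCoeff k) hw
    exact Summable.of_norm_bounded (hgeom.mul_left B) fun m => hB _ (hge m)
  have hlim : Tendsto (fun m : ℕ => lambertU k t (w + 2 * π * t * m)) atTop (𝓝 0) := by
    obtain ⟨B, hB⟩ := exists_norm_expSeries_le (powBound_lambertCoeff k ht) hw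
    refine squeeze_zero_norm (fun m => hB _ (hge m)) ?_
    simpa using hgeom.tendsto_atTop_zero.const_mul B
  rw [hsum.hasSum_iff_tendsto_nat]
  have hpart : ∀ M : ℕ, ∑ m ∈ Finset.range M, expSeries (liCoeff k) (w + 2 * π * t * m) =
      lambertU k t w - lambertU k t (w + 2 * π * t * M) := by
    intro M
    induction M with
    | zero => simp
    | succ M ih =>
      rw [Finset.sum_range_succ, ih, lambertU_sub_shift k ht (w := w + 2 * π * t * M)
        (Or.inl (hw.trans_le (hge M)))]
      push_cast
      rw [mul_add (2 * π * t : ℂ), mul_one, ← add_assoc]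
      ring
  simp_rw [hpart]
  simpa using tendsto_const_nhds.sub hlim

/-- The enumeration of the integers `l` with `0 < x + l`. -/
def natEquivPosShift (x : ℝ) : ℕ ≃ {l : ℤ // 0 < x + (l : ℝ)} where
  toFun m := ⟨m + (⌊-x⌋ + 1), by
    push_cast
    have := Int.lt_floor_add_one (-x)
    have := m.cast_nonneg (α := ℝ)
    linarith⟩
  invFun l := (l.1 - (⌊-x⌋ + 1)).toNat
  left_inv m := by simp
  right_inv l := by
    have h : ⌊-x⌋ < l.1 := Int.floor_lt.mpr (by linarith [l.2])
    ext
    simp only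
    lia

theorem natEquivPosShift_add (x : ℝ) (m : ℕ) :
    x + ((natEquivPosShift x m).1 : ℝ) = fracP x + m := by
  simp only [natEquivPosShift, Equiv.coe_fn_mk, fracP, Int.fract]
  push_cast; ring

theorem fracP_pos (x : ℝ) : 0 < fracP x := by
  have := Int.fract_lt_one (-x)
  unfold fracP; linarith

theorem Scal_eq_lambertU (k : ℤ) (α β : ℝ) {t : ℂ} (ht : 0 < t.re) :
    Scal (k : ℂ) β 0 0 α t = lambertU k t (2 * π * (t * fracP β - I * α)) := by
  have hw : 0 < (2 * π * (t * fracP β - I * α) : ℂ).re := by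
    rw [re_left_arg]; have := fracP_pos β; positivity
  rw [← (hasSum_expSeries_liCoeff_shift k ht hw).tsum_eq, Scal,
    ← (natEquivPosShift β).tsum_eq]
  refine tsum_congr fun m => ?_
  rw [← (natEquivPosShift 0).tsum_eq, expSeries]
  refine tsum_congr fun n => ?_
  rw [natEquivPosShift_add, natEquivPosShift_add]
  have h0 : fracP 0 + (n : ℝ) = (n : ℝ) + 1 := by simp [fracP]; ring
  rw [h0, ee, liCoeff, ← Int.cast_neg, Complex.cpow_intCast]
  push_cast
  rw [mul_comm (Complex.exp _), mul_assoc, ← Complex.exp_add]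
  congr 2
  ring

end

section

open Filter Topology HurwitzZeta

theorem expSeries_liCoeff_eq_expZeta {k : ℤ} (hk : 2 ≤ k) (a : ℝ) :
    expSeries (liCoeff k) (-(2 * π * I * a)) = expZeta (a : UnitAddCircle) k := by
  have h := hasSum_expZeta_of_one_lt_re a (s := (k : ℂ)) (by
    rw [Complex.intCast_re]; exact_mod_cast (by lia : 1 < k))
  rw [← hasSum_nat_add_iff' 1] at h
  have hk0 : k ≠ 0 := by lia
  simp only [Finset.range_one, Finset.sum_singleton, Nat.cast_zero, Complex.cpow_intCast,
    zero_zpow k hk0, div_zero, sub_zero] at h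
  rw [← h.tsum_eq, expSeries]
  refine tsum_congr fun n => ?_
  rw [liCoeff, zpow_neg, div_eq_mul_inv, mul_comm]
  push_cast
  congr 2
  ring

theorem tendsto_expSeries_of_two_le {k : ℤ} (hk : 2 ≤ k) {t : ℂ} (ht : 0 < t.re) (a : ℝ) :
    Tendsto (fun x : ℝ => expSeries (liCoeff k) (2 * π * (t * x - I * a))) (𝓝[>] 0)
      (𝓝 (expZeta (a : UnitAddCircle) k)) := by
  have h := (continuousOn_expSeries (powBound_liCoeff k) (by lia)).comp
    (f := fun x : ℝ => (2 * π * (t * x - I * a) : ℂ)) (s := Set.Ici 0) (by fun_prop)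
    (fun x hx => by
      simp only [Set.mem_ofPred_eq]
      rw [re_left_arg]; exact mul_nonneg (by positivity) hx)
  have h2 := (h 0 Set.self_mem_Ici).tendsto.mono_left (nhdsWithin_mono _ Set.Ioi_subset_Ici_self)
  rw [← expSeries_liCoeff_eq_expZeta hk a]
  convert! h2 using 2
  simp only [Function.comp]
  congr 1
  push_cast; ring

theorem norm_add_int_ge {a : ℝ} (ha : a ∈ Set.Ioo (0 : ℝ) 1) (n : ℤ) :
    min a (1 - a) ≤ |(n : ℝ) + a| := by
  rcases lt_or_ge n 0 with h | h
  · have h1 : (n : ℝ) ≤ -1 := by exact_mod_cast (by lia : n ≤ -1)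
    rw [abs_of_nonpos (by linarith [ha.2])]
    exact (min_le_right _ _).trans (by linarith)
  · have h1 : (0 : ℝ) ≤ n := by exact_mod_cast h
    rw [abs_of_nonneg (by linarith [ha.1])]
    exact (min_le_left _ _).trans (by linarith)

theorem tendsto_tsum_int_inv_pow {K : ℕ} (hK : 1 ≤ K) (t : ℂ) {a : ℝ}
    (ha : a ∈ Set.Ioo (0 : ℝ) 1) :
    Tendsto (fun x : ℝ => ∑' n : ℤ, 1 / ((a + I * t * x : ℂ) + n) ^ (K + 1)) (𝓝[>] 0)
      (𝓝 (∑' n : ℤ, 1 / ((a : ℂ) + n) ^ (K + 1))) := by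
  have hd : 0 < min a (1 - a) := lt_min ha.1 (by linarith [ha.2])
  have hs : Summable fun n : ℤ => 2 ^ (K + 1) * (1 / |(n : ℝ) + a| ^ (K + 1)) := by
    refine Summable.mul_left _ ?_
    have := (Real.summable_one_div_int_add_rpow a (K + 1 : ℕ)).mpr
      (by exact_mod_cast (by lia : 1 < K + 1))
    simpa only [Real.rpow_natCast] using this
  have hne : ∀ n : ℤ, (a : ℂ) + n ≠ 0 := fun n h => by
    have h1 := norm_add_int_ge ha n
    have h2 : (n : ℝ) + a = 0 := by
      have := congrArg Complex.re h
      simp at this; linarith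
    rw [h2, abs_zero] at h1; linarith
  refine tendsto_tsum_of_dominated_convergence hs (fun n => ?_) ?_
  · have hc : ContinuousAt (fun x : ℝ => 1 / ((a + I * t * x : ℂ) + n) ^ (K + 1)) 0 := by
      refine ContinuousAt.div continuousAt_const (by fun_prop) (pow_ne_zero _ ?_)
      simpa using hne n
    have := hc.tendsto.mono_left (nhdsWithin_le_nhds (s := Set.Ioi 0))
    simpa using this
  · have hsmall : ∀ᶠ x : ℝ in 𝓝[>] 0, ‖t‖ * |x| ≤ min a (1 - a) / 2 := by
      have hc : ContinuousAt (fun x : ℝ => ‖t‖ * |x|) 0 := by fun_prop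
      have h0 : ‖t‖ * |(0 : ℝ)| < min a (1 - a) / 2 := by simpa using hd
      exact ((hc.eventually_lt continuousAt_const h0).filter_mono nhdsWithin_le_nhds).mono
        fun x hx => hx.le
    filter_upwards [hsmall] with x hx n
    have h1 := norm_add_int_ge ha n
    have h2 : |(n : ℝ) + a| / 2 ≤ ‖(a + I * t * x : ℂ) + n‖ := by
      have h3 : ‖(a : ℂ) + n‖ = |(n : ℝ) + a| := by
        rw [add_comm, ← Real.norm_eq_abs, ← Complex.norm_real]; push_cast; rfl
      have h4 : ‖I * t * (x : ℂ)‖ = ‖t‖ * |x| := by simp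
      have h5 : (a + I * t * x : ℂ) + n = ((a : ℂ) + n) + I * t * x := by ring
      have h6 := norm_sub_norm_le ((a : ℂ) + n) (-(I * t * x))
      rw [norm_neg, h3, h4, sub_neg_eq_add] at h6
      rw [h5]; linarith
    have hpos : 0 < |(n : ℝ) + a| := hd.trans_le h1
    rw [norm_div, norm_one, norm_pow]
    calc 1 / ‖(a + I * t * x : ℂ) + n‖ ^ (K + 1) ≤ 1 / (|(n : ℝ) + a| / 2) ^ (K + 1) := by
          gcongr
      _ = _ := by rw [div_pow]; field_simp

theorem tsum_int_inv_pow_eq_expZeta {K : ℕ} (hK : 1 ≤ K) {a : ℝ} (ha : a ∈ Set.Ioo (0 : ℝ) 1) :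
    ∑' n : ℤ, 1 / ((a : ℂ) + n) ^ (K + 1) =
      (-2 * π * I) ^ (K + 1) / (K.factorial : ℂ) * expZeta (a : UnitAddCircle) (-(K : ℂ)) := by
  have hre : 1 < ((K : ℂ) + 1).re := by
    simp only [Complex.add_re, Complex.natCast_re, Complex.one_re]
    have : (1 : ℝ) ≤ K := by exact_mod_cast hK
    linarith
  have h1 := hasSum_hurwitzZeta_of_one_lt_re (Set.Ioo_subset_Icc_self ha) hre
  have h2 := hasSum_hurwitzZeta_of_one_lt_re (a := 1 - a)
    ⟨by linarith [ha.2], by linarith [ha.1]⟩ hre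
  have hq : ((1 - a : ℝ) : UnitAddCircle) = -(a : UnitAddCircle) := by
    rw [AddCircle.coe_sub, AddCircle.coe_period, zero_sub]
  rw [hq] at h2
  have hE := expZeta_one_sub (a : UnitAddCircle) (s := (K : ℂ) + 1) (fun n h => by
    have h' : (K : ℂ) + n = 0 := by linear_combination h
    have : K + n = 0 := by exact_mod_cast h'
    lia)
  rw [show 1 - ((K : ℂ) + 1) = -(K : ℂ) by ring] at hE
  have hcast : ((K : ℂ) + 1) = ((K + 1 : ℕ) : ℂ) := by push_cast; rfl
  have h3 : HasSum (fun n : ℤ => 1 / ((a : ℂ) + n) ^ (K + 1))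
      (hurwitzZeta (a : UnitAddCircle) (K + 1) +
        (-1) ^ (K + 1) * hurwitzZeta (-(a : UnitAddCircle)) (K + 1)) := by
    refine HasSum.of_nat_of_neg_add_one ?_ ?_
    · refine h1.congr_fun fun n => ?_
      rw [hcast, Complex.cpow_natCast, add_comm (n : ℂ)]
      push_cast; rfl
    · refine (h2.mul_left ((-1 : ℂ) ^ (K + 1))).congr_fun fun n => ?_
      rw [hcast, Complex.cpow_natCast]
      push_cast
      rw [show (a : ℂ) + -(n + 1) = -1 * (n + (1 - a)) by ring, mul_pow, one_div, one_div,
        mul_inv, ← inv_pow]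
      norm_num
  rw [h3.tsum_eq, hE]
  have e1 : Complex.exp (π * I * (K + 1) / 2) = I ^ (K + 1) := by
    rw [show (π * I * (K + 1) / 2 : ℂ) = ((K + 1 : ℕ) : ℂ) * (π / 2 * I) by push_cast; ring,
      Complex.exp_nat_mul, Complex.exp_pi_div_two_mul_I]
  have e2 : Complex.exp (-π * I * (K + 1) / 2) = (-I) ^ (K + 1) := by
    rw [← Complex.exp_neg_pi_div_two_mul_I, ← Complex.exp_nat_mul]
    congr 1; push_cast; ring
  rw [e1, e2, hcast, Complex.cpow_neg, Complex.cpow_natCast, ← hcast,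
    Complex.Gamma_nat_eq_factorial]
  have hf : (K.factorial : ℂ) ≠ 0 := by exact_mod_cast K.factorial_ne_zero
  have hp : (2 * (π : ℂ)) ^ (K + 1) ≠ 0 := pow_ne_zero _ (by simp [Real.pi_ne_zero])
  rw [show (-2 * π * I : ℂ) = (2 * π) * (-I) by ring, mul_pow]
  have hI1 : (-I) ^ (K + 1) * I ^ (K + 1) = 1 := by rw [← mul_pow]; simp
  have hI2 : (-I) ^ (K + 1) * (-I) ^ (K + 1) = (-1) ^ (K + 1) := by rw [← mul_pow]; simp
  field_simp
  linear_combination -hurwitzZeta (a : UnitAddCircle) (K + 1) * hI1 -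
    hurwitzZeta (-(a : UnitAddCircle)) (K + 1) * hI2

theorem tendsto_expSeries_of_neg {K : ℕ} (hK : 1 ≤ K) {t : ℂ} (ht : 0 < t.re) {a : ℝ}
    (ha : a ∈ Set.Ioo (0 : ℝ) 1) :
    Tendsto (fun x : ℝ => expSeries (liCoeff (-K)) (2 * π * (t * x - I * a))) (𝓝[>] 0)
      (𝓝 (expZeta (a : UnitAddCircle) (-(K : ℂ)))) := by
  have hc : (-2 * π * I : ℂ) ^ (K + 1) / (K.factorial : ℂ) ≠ 0 := by
    refine div_ne_zero (pow_ne_zero _ (by simp [Real.pi_ne_zero])) ?_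
    exact_mod_cast K.factorial_ne_zero
  have h := (tendsto_tsum_int_inv_pow hK t ha).const_mul
    ((-2 * π * I : ℂ) ^ (K + 1) / (K.factorial : ℂ))⁻¹
  rw [tsum_int_inv_pow_eq_expZeta hK ha, inv_mul_cancel_left₀ hc] at h
  refine h.congr' ?_
  filter_upwards [self_mem_nhdsWithin] with x hx
  have him : 0 < (a + I * t * x : ℂ).im := by simpa using mul_pos ht hx
  have hq := EisensteinSeries.qExpansion_identity hK ⟨a + I * t * x, him⟩
  simp only at hq
  rw [hq, inv_mul_cancel_left₀ hc, expSeries]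
  have hsum : Summable fun n : ℕ => (n : ℂ) ^ K * Complex.exp (2 * π * I * (a + I * t * x)) ^ n :=
    summable_pow_mul_geometric_of_norm_lt_one K (by
      rw [Complex.norm_exp, Real.exp_lt_one_iff]
      have hx' : 0 < t.re * x := mul_pos ht hx
      have : 0 < π * (t.re * x) := by positivity
      simp
      nlinarith)
  rw [hsum.tsum_eq_zero_add]
  simp only [Nat.cast_zero, zero_pow (by lia : K ≠ 0), zero_mul, zero_add]
  refine tsum_congr fun n => ?_
  rw [liCoeff, neg_neg, zpow_natCast, ← Complex.exp_nat_mul]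
  push_cast
  congr 2
  linear_combination 2 * π * t * x * (n + 1) * I_sq

theorem abs_rpow_neg_sub_le {n : ℕ} (hn : 1 ≤ n) {a s : ℝ} (ha : a ∈ Set.Ioo (0 : ℝ) 1)
    (hs : 1 ≤ s) (hs2 : s ≤ 2) :
    |((n : ℝ) + a) ^ (-s) - ((n : ℝ) + 1 - a) ^ (-s)| ≤ 2 * (n : ℝ) ^ (-2 : ℤ) := by
  have hn0 : (0 : ℝ) < n := by exact_mod_cast hn
  have hn1 : (1 : ℝ) ≤ n := by exact_mod_cast hn
  have mono : ∀ {x : ℝ}, (n : ℝ) ≤ x → x ≤ n + 1 →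
      ((n : ℝ) + 1) ^ (-s) ≤ x ^ (-s) ∧ x ^ (-s) ≤ (n : ℝ) ^ (-s) := fun {x} h1 h2 =>
    ⟨Real.rpow_le_rpow_of_nonpos (by linarith) h2 (by linarith),
      Real.rpow_le_rpow_of_nonpos hn0 h1 (by linarith)⟩
  have m1 := mono (x := (n : ℝ) + a) (by linarith [ha.1]) (by linarith [ha.2])
  have m2 := mono (x := (n : ℝ) + 1 - a) (by linarith [ha.2]) (by linarith [ha.1])
  have h1 : |((n : ℝ) + a) ^ (-s) - ((n : ℝ) + 1 - a) ^ (-s)| ≤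
      (n : ℝ) ^ (-s) - ((n : ℝ) + 1) ^ (-s) := by
    rw [abs_le]; constructor <;> linarith [m1.1, m1.2, m2.1, m2.2]
  refine h1.trans ?_
  have hr : (n : ℝ) ^ 2 / ((n : ℝ) + 1) ^ 2 ≤ ((n : ℝ) / (n + 1)) ^ s := by
    rw [← div_pow, ← Real.rpow_natCast]
    exact Real.rpow_le_rpow_of_exponent_ge (by positivity)
      ((div_le_one (by positivity)).mpr (by linarith)) (by exact_mod_cast hs2)
  have he : ((n : ℝ) + 1) ^ (-s) = (n : ℝ) ^ (-s) * ((n : ℝ) / (n + 1)) ^ s := by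
    rw [Real.div_rpow hn0.le (by positivity), Real.rpow_neg hn0.le, Real.rpow_neg (by positivity)]
    have := (Real.rpow_pos_of_pos hn0 s).ne'
    field_simp
  have hle : (n : ℝ) ^ (-s) ≤ (n : ℝ)⁻¹ := by
    rw [← Real.rpow_neg_one]
    exact Real.rpow_le_rpow_of_exponent_le hn1 (by linarith)
  have hr1 : 0 ≤ 1 - (n : ℝ) ^ 2 / ((n : ℝ) + 1) ^ 2 := by
    rw [sub_nonneg, div_le_one (by positivity)]; nlinarith
  calc (n : ℝ) ^ (-s) - ((n : ℝ) + 1) ^ (-s)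
      = (n : ℝ) ^ (-s) * (1 - ((n : ℝ) / (n + 1)) ^ s) := by rw [he]; ring
    _ ≤ (n : ℝ) ^ (-s) * (1 - (n : ℝ) ^ 2 / ((n : ℝ) + 1) ^ 2) := by gcongr
    _ ≤ (n : ℝ)⁻¹ * (1 - (n : ℝ) ^ 2 / ((n : ℝ) + 1) ^ 2) := by gcongr
    _ ≤ _ := by
      rw [zpow_neg, show ((n : ℝ) ^ (2 : ℤ)) = (n : ℝ) ^ 2 from by norm_cast]
      rw [one_sub_div (by positivity), ← div_eq_inv_mul, div_div, ← div_eq_mul_inv,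
        div_le_div_iff₀ (by positivity) (by positivity)]
      nlinarith [mul_pos hn0 hn0, mul_pos (mul_pos hn0 hn0) hn0]

theorem hurwitzZetaOdd_one {a : ℝ} (ha : a ∈ Set.Ioo (0 : ℝ) 1) :
    hurwitzZetaOdd (a : UnitAddCircle) 1 = π / 2 * Complex.cot (π * a) := by
  have ha0 : (0 : ℝ) < 1 - a := by linarith [ha.2]
  have h_int : (a : ℂ) ∈ Complex.integerComplement := by
    rintro ⟨n, hn⟩
    have : (n : ℝ) = a := by exact_mod_cast hn
    rw [← this] at ha
    have h1 : (0 : ℤ) < n := by exact_mod_cast ha.1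
    have h2 : n < (1 : ℤ) := by exact_mod_cast ha.2
    lia
  have hpos : ∀ n : ℕ, (0 : ℝ) < n + a := fun n => by have := ha.1; positivity
  have hpos' : ∀ n : ℕ, (0 : ℝ) < n + 1 - a := fun n => by
    have := n.cast_nonneg (α := ℝ); linarith
  set f : ℝ → ℕ → ℂ := fun s n =>
    (((((n : ℝ) + a) ^ (-s) - ((n : ℝ) + 1 - a) ^ (-s)) / 2 : ℝ) : ℂ) with hf
  have hval : ∀ s : ℝ, 1 < s → ∑' n, f s n = hurwitzZetaOdd (a : UnitAddCircle) s := by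
    intro s hs
    rw [← (hasSum_nat_hurwitzZetaOdd_of_mem_Icc (Set.Ioo_subset_Icc_self ha)
      (s := (s : ℂ)) (by simpa using hs)).tsum_eq]
    refine tsum_congr fun n => ?_
    simp only [hf]
    push_cast
    rw [Complex.ofReal_cpow (hpos n).le, Complex.ofReal_cpow (hpos' n).le]
    push_cast
    rw [Complex.cpow_neg, Complex.cpow_neg, one_div, one_div]
  have hlim1 : Tendsto (fun s : ℝ => ∑' n, f s n) (𝓝[>] 1)
      (𝓝 (hurwitzZetaOdd (a : UnitAddCircle) 1)) := by
    have hc : Continuous fun s : ℝ => hurwitzZetaOdd (a : UnitAddCircle) (s : ℂ) :=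
      (differentiable_hurwitzZetaOdd (a : UnitAddCircle)).continuous.comp continuous_ofReal
    have := (hc.tendsto 1).mono_left (nhdsWithin_le_nhds (s := Set.Ioi 1))
    rw [ofReal_one] at this
    exact this.congr' (by filter_upwards [self_mem_nhdsWithin] with s hs using (hval s hs).symm)
  have hlim2 : Tendsto (fun s : ℝ => ∑' n, f s n) (𝓝[>] 1) (𝓝 (∑' n, f 1 n)) := by
    refine tendsto_tsum_of_dominated_convergence
      (bound := fun n : ℕ => if n = 0 then a ^ (-2 : ℝ) + (1 - a) ^ (-2 : ℝ)
        else 2 * (n : ℝ) ^ (-2 : ℤ)) ?_ (fun n => ?_) ?_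
    · have : Summable fun n : ℕ => 2 * (n : ℝ) ^ (-2 : ℤ) := by
        refine Summable.mul_left _ ?_
        have := Real.summable_nat_pow_inv (p := 2) |>.mpr (by norm_num)
        refine this.congr fun n => ?_
        rw [zpow_neg]; norm_cast
      refine this.congr_cofinite ?_
      filter_upwards [(Set.finite_singleton (0 : ℕ)).compl_mem_cofinite] with n hn
      rw [if_neg (by simpa using hn)]
    · have hc : Continuous fun s : ℝ => f s n := by
        refine continuous_ofReal.comp (Continuous.div_const (Continuous.sub ?_ ?_) _)
        · exact Continuous.rpow continuous_const continuous_neg fun _ => Or.inl (hpos n).ne'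
        · exact Continuous.rpow continuous_const continuous_neg fun _ => Or.inl (hpos' n).ne'
      exact (hc.tendsto 1).mono_left nhdsWithin_le_nhds
    · filter_upwards [Ioo_mem_nhdsGT (show (1 : ℝ) < 2 by norm_num)] with s hs n
      simp only [hf]
      rw [Complex.norm_real, Real.norm_eq_abs, abs_div, abs_two]
      split_ifs with hn
      · subst hn
        have h1 : a ^ (-s) ≤ a ^ (-2 : ℝ) :=
          Real.rpow_le_rpow_of_exponent_ge ha.1 ha.2.le (by linarith [hs.2])
        have h2 : (1 - a) ^ (-s) ≤ (1 - a) ^ (-2 : ℝ) :=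
          Real.rpow_le_rpow_of_exponent_ge ha0 (by linarith [ha.1]) (by linarith [hs.2])
        have h3 := Real.rpow_pos_of_pos ha.1 (-s)
        have h4 := Real.rpow_pos_of_pos ha0 (-s)
        have : |a ^ (-s) - (1 - a) ^ (-s)| ≤ a ^ (-2 : ℝ) + (1 - a) ^ (-2 : ℝ) := by
          rw [abs_le]; constructor <;> linarith
        rw [Nat.cast_zero, zero_add, zero_add]
        linarith [abs_nonneg (a ^ (-s) - (1 - a) ^ (-s))]
      · have := abs_rpow_neg_sub_le (by lia : 1 ≤ n) ha hs.1.le hs.2.le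
        linarith [abs_nonneg (((n : ℝ) + a) ^ (-s) - ((n : ℝ) + 1 - a) ^ (-s))]
  rw [tendsto_nhds_unique hlim1 hlim2]
  have hcot := cot_series_rep' h_int
  have hs1 : Summable fun n : ℕ => 1 / ((a : ℂ) - (n + 1)) + 1 / ((a : ℂ) + (n + 1)) := by
    simpa only [cotTerm] using summable_cotTerm h_int
  have hne : ∀ n : ℕ, (n : ℂ) + a ≠ 0 := fun n => by exact_mod_cast (hpos n).ne'
  have hne' : ∀ n : ℕ, (a : ℂ) - (n + 1) ≠ 0 := fun n h => by
    have h' : (n : ℝ) + 1 - a = 0 := by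
      have := congrArg Complex.re h
      simp at this; linarith
    exact (hpos' n).ne' h'
  have htel : HasSum (fun n : ℕ => 1 / ((n : ℂ) + a) - 1 / (((n + 1 : ℕ) : ℂ) + a)) (1 / (a : ℂ)) := by
    have hR : HasSum (fun n : ℕ => 1 / ((n : ℝ) + a) - 1 / (((n + 1 : ℕ) : ℝ) + a)) (1 / a) := by
      rw [hasSum_iff_tendsto_nat_of_nonneg]
      · have hlim : Tendsto (fun n : ℕ => 1 / a - 1 / ((n : ℝ) + a)) atTop (𝓝 (1 / a - 0)) :=
          tendsto_const_nhds.sub (tendsto_const_nhds.div_atTop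
            (tendsto_atTop_add_const_right _ _ tendsto_natCast_atTop_atTop))
        rw [sub_zero] at hlim
        refine hlim.congr fun n => ?_
        rw [Finset.sum_range_sub' (fun n : ℕ => 1 / ((n : ℝ) + a)), Nat.cast_zero, zero_add]
      · intro n
        rw [sub_nonneg]
        exact one_div_le_one_div_of_le (hpos n) (by push_cast; linarith)
    convert hR.mapL Complex.ofRealCLM using 2 <;> simp
  have h := (htel.add hs1.hasSum).div_const 2
  rw [← hcot] at h
  rw [show (π / 2 * Complex.cot (π * a) : ℂ) =
    (1 / (a : ℂ) + (π * Complex.cot (π * a) - 1 / a)) / 2 by ring, ← h.tsum_eq]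
  refine tsum_congr fun n => ?_
  simp only [hf, Real.rpow_neg_one]
  push_cast
  have h1 := hne n
  have h2 := hne' n
  have h3 := hne (n + 1)
  push_cast at h3
  rw [show (n : ℂ) + 1 - a = -(a - (n + 1)) by ring, show (a : ℂ) + (n + 1) = n + 1 + a by ring,
    inv_neg]
  simp only [one_div]
  ring

theorem one_sub_exp_two_pi_I_ne_zero {a : ℝ} (ha : a ∈ Set.Ioo (0 : ℝ) 1) :
    1 - Complex.exp (2 * π * I * a) ≠ 0 := by
  intro h
  obtain ⟨n, hn⟩ := Complex.exp_eq_one_iff.mp (sub_eq_zero.mp h).symm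
  have hn' : (a : ℂ) = n :=
    mul_left_cancel₀ Complex.two_pi_I_ne_zero (hn.trans (mul_comm _ _))
  have hn'' : a = n := by exact_mod_cast hn'
  rw [hn''] at ha
  have h1 : (0 : ℤ) < n := by exact_mod_cast ha.1
  have h2 : n < (1 : ℤ) := by exact_mod_cast ha.2
  lia

theorem expZeta_zero_right {a : ℝ} (ha : a ∈ Set.Ioo (0 : ℝ) 1) :
    expZeta (a : UnitAddCircle) 0 =
      Complex.exp (2 * π * I * a) / (1 - Complex.exp (2 * π * I * a)) := by
  have hs := sinZeta_one_sub (a : UnitAddCircle) (s := 1) (fun n h => by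
    have h' : ((1 + n : ℕ) : ℂ) = 0 := by push_cast; linear_combination h
    have : 1 + n = 0 := by exact_mod_cast h'
    lia)
  have hne : 1 - Complex.exp (2 * π * I * a) ≠ 0 := one_sub_exp_two_pi_I_ne_zero ha
  have hpi : (π : ℂ) ≠ 0 := by exact_mod_cast Real.pi_ne_zero
  rw [sub_self, hurwitzZetaOdd_one ha, Complex.Gamma_one, mul_one, mul_one,
    Complex.sin_pi_div_two, Complex.cpow_neg_one, Complex.cot_pi_eq_exp_ratio] at hs
  rw [expZeta, cosZeta_apply_zero, hs]
  generalize Complex.exp (2 * π * I * a) = e at hne ⊢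
  have hI := I_ne_zero
  field_simp
  ring

theorem tendsto_expSeries_zero {t : ℂ} (ht : 0 < t.re) {a : ℝ} (ha : a ∈ Set.Ioo (0 : ℝ) 1) :
    Tendsto (fun x : ℝ => expSeries (liCoeff 0) (2 * π * (t * x - I * a))) (𝓝[>] 0)
      (𝓝 (expZeta (a : UnitAddCircle) 0)) := by
  rw [expZeta_zero_right ha]
  have hne : 1 - Complex.exp (2 * π * I * a) ≠ 0 := one_sub_exp_two_pi_I_ne_zero ha
  have hc : Continuous fun x : ℝ => Complex.exp (-(2 * π * (t * x - I * a))) := by fun_prop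
  have h0 : Complex.exp (-(2 * π * (t * ((0 : ℝ) : ℂ) - I * a))) =
      Complex.exp (2 * π * I * a) := by
    congr 1; push_cast; ring
  have h1 := hc.tendsto 0
  rw [h0] at h1
  have h2 := (h1.div (tendsto_const_nhds.sub h1) hne).mono_left
    (nhdsWithin_le_nhds (s := Set.Ioi (0 : ℝ)))
  refine h2.congr' ?_
  filter_upwards [self_mem_nhdsWithin] with x hx
  have hn : ‖Complex.exp (-(2 * π * (t * x - I * a)))‖ < 1 := by
    rw [Complex.norm_exp, Real.exp_lt_one_iff]
    have hx' : 0 < t.re * x := mul_pos ht hx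
    have : 0 < π * (t.re * x) := by positivity
    simp
    nlinarith
  have hg := (hasSum_geometric_of_norm_lt_one hn).mul_left
    (Complex.exp (-(2 * π * (t * x - I * a))))
  rw [Pi.div_apply, div_eq_mul_inv, ← hg.tsum_eq, expSeries]
  refine tsum_congr fun n => ?_
  rw [liCoeff, neg_zero, zpow_zero, one_mul, ← pow_succ', ← Complex.exp_nat_mul]
  congr 1; push_cast; ring

theorem tendsto_expSeries_liCoeff {k : ℤ} {t : ℂ} (ht : 0 < t.re) {a : ℝ}
    (h : 2 ≤ k ∨ k ≠ 1 ∧ a ∈ Set.Ioo (0 : ℝ) 1) :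
    Tendsto (fun x : ℝ => expSeries (liCoeff k) (2 * π * (t * x - I * a))) (𝓝[>] 0)
      (𝓝 (expZeta (a : UnitAddCircle) k)) := by
  by_cases hk : 2 ≤ k
  · exact tendsto_expSeries_of_two_le hk ht a
  · obtain ⟨h1, ha⟩ := h.resolve_left hk
    obtain ⟨K, hK⟩ := Int.eq_ofNat_of_zero_le (show 0 ≤ -k by lia)
    obtain rfl : k = -(K : ℤ) := by lia
    rcases Nat.eq_zero_or_pos K with rfl | hK
    · simpa using tendsto_expSeries_zero ht ha
    · simpa using tendsto_expSeries_of_neg hK ht ha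

end

section

open Filter Topology HurwitzZeta EisensteinSeries
open UpperHalfPlane hiding I

theorem mul_riemannZeta_one_sub_two_mul {m : ℕ} (hm : 1 ≤ m) :
    (-2 * π * I : ℂ) ^ (2 * m) / ((2 * m - 1).factorial : ℂ) * riemannZeta (1 - 2 * m) =
      2 * riemannZeta (2 * m) := by
  have h2 : ((2 * m : ℕ) : ℂ) = 2 * m := by push_cast; rfl
  have h := riemannZeta_one_sub (s := 2 * m) (fun n hn => by
    have h' : ((2 * m + n : ℕ) : ℂ) = 0 := by push_cast; linear_combination hn
    have : 2 * m + n = 0 := by exact_mod_cast h'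
    lia) (fun hn => by
    have : 2 * m = 1 := by exact_mod_cast hn
    lia)
  have hG : Complex.Gamma (2 * m) = ((2 * m - 1).factorial : ℂ) := by
    rw [← Complex.Gamma_nat_eq_factorial]
    congr 1
    have : ((2 * m - 1 + 1 : ℕ) : ℂ) = 2 * m := by rw [Nat.sub_add_cancel (by lia)]; exact h2
    rw [← this]; push_cast; rfl
  have hcos : Complex.cos (π * (2 * m) / 2) = (-1) ^ m := by
    rw [show (π * (2 * m) / 2 : ℂ) = ((m * π : ℝ) : ℂ) by push_cast; ring, ← Complex.ofReal_cos,
      Real.cos_nat_mul_pi]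
    push_cast; rfl
  rw [h, hG, hcos, Complex.cpow_neg, ← h2, Complex.cpow_natCast]
  have hf : ((2 * m - 1).factorial : ℂ) ≠ 0 := by exact_mod_cast Nat.factorial_ne_zero _
  have hp : (2 * (π : ℂ)) ^ (2 * m) ≠ 0 := pow_ne_zero _ (by simp [Real.pi_ne_zero])
  have hI : (-I) ^ (2 * m) * (-1) ^ m = 1 := by
    rw [pow_mul, ← mul_pow]; simp
  rw [show (-2 * π * I : ℂ) = (2 * π) * (-I) by ring, mul_pow]
  generalize riemannZeta ((2 * m : ℕ) : ℂ) = z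
  field_simp
  linear_combination z * hI

theorem lambertU_two_pi_mul {m : ℕ} (hm : 1 ≤ m) {t : ℂ} (ht : 0 < t.re) :
    lambertU (1 - 2 * m) t (2 * π * t) =
      ∑' n : ℕ+, (ArithmeticFunction.sigma (2 * m - 1) n : ℂ) *
        Complex.exp (2 * π * I * (I * t)) ^ (n : ℕ) := by
  have hr : ‖Complex.exp (2 * π * I * (I * t))‖ < 1 := by
    rw [Complex.norm_exp, Real.exp_lt_one_iff]
    have : 0 < 2 * π * t.re := by positivity
    simp
    nlinarith
  rw [← tsum_pow_div_one_sub_eq_tsum_sigma hr,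
    tsum_pnat_eq_tsum_succ (f := fun n : ℕ => (n : ℂ) ^ (2 * m - 1) *
      Complex.exp (2 * π * I * (I * t)) ^ n / (1 - Complex.exp (2 * π * I * (I * t)) ^ n)),
    lambertU, expSeries]
  refine tsum_congr fun n => ?_
  have he : Complex.exp (-(((n : ℂ) + 1) * (2 * π * t))) =
      Complex.exp (2 * π * I * (I * t)) ^ (n + 1) := by
    rw [← Complex.exp_nat_mul]
    congr 1; push_cast
    linear_combination -(2 * π * t) * (n + 1) * I_sq
  rw [lambertCoeff, he, liCoeff, show (-(1 - 2 * m) : ℤ) = ((2 * m - 1 : ℕ) : ℤ) by lia,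
    zpow_natCast]
  push_cast
  ring

/-- The value of the Lambert side at the origin for `k = 1 - 2 m`. -/
def lambertEis (m : ℕ) (t : ℂ) : ℂ :=
  riemannZeta (1 - 2 * m) + 2 * lambertU (1 - 2 * m) t (2 * π * t)

theorem tsum_eisSummand_smul_S {k : ℕ} (z : ℍ) :
    ∑' v : Fin 2 → ℤ, eisSummand k v (ModularGroup.S • z) =
      (z : ℂ) ^ k * ∑' v : Fin 2 → ℤ, eisSummand k v z := by
  simp_rw [eisSummand_SL2_apply, tsum_mul_left, ModularGroup.denom_S]
  congr 1
  let e : (Fin 2 → ℤ) ≃ (Fin 2 → ℤ) :=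
    { toFun := fun v => ![v 1, -v 0]
      invFun := fun v => ![-v 1, v 0]
      left_inv := fun v => by ext i; fin_cases i <;> simp
      right_inv := fun v => by ext i; fin_cases i <;> simp }
  have he : ∀ v : Fin 2 → ℤ, Matrix.vecMul v (ModularGroup.S : Matrix (Fin 2) (Fin 2) ℤ) = e v :=
    fun v => by
      ext i
      fin_cases i <;> simp [e, ModularGroup.S, Matrix.vecMul, dotProduct, Fin.sum_univ_two]
  simp_rw [he]
  exact e.tsum_eq (fun v => eisSummand k v z)

theorem lambertEis_eq_tsum {m : ℕ} (hm : 2 ≤ m) {t : ℂ} (ht : 0 < t.re) :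
    (-2 * π * I : ℂ) ^ (2 * m) / ((2 * m - 1).factorial : ℂ) * lambertEis m t =
      ∑' v : Fin 2 → ℤ, eisSummand (2 * m : ℕ) v ⟨I * t, (Complex.I_mul_im t).symm ▸ ht⟩ := by
  rw [tsum_eisSummand_eq_tsum_sigma_mul_cexp_pow (by lia) (by simp), lambertEis, mul_add,
    mul_riemannZeta_one_sub_two_mul (by lia), lambertU_two_pi_mul (by lia) ht]
  push_cast
  ring

theorem lambertEis_one {t : ℂ} (ht : 0 < t.re) :
    (-2 * π * I : ℂ) ^ 2 * lambertEis 1 t = G2 ⟨I * t, (Complex.I_mul_im t).symm ▸ ht⟩ := by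
  have h := mul_riemannZeta_one_sub_two_mul le_rfl
  rw [G2_eq_tsum_cexp, lambertEis, lambertU_two_pi_mul le_rfl ht]
  norm_num at h ⊢
  rw [mul_add, h, mul_pow, I_sq]
  ring

theorem S_smul_I_mul {t : ℂ} (ht : 0 < t.re) :
    ModularGroup.S • (⟨I * t, (Complex.I_mul_im t).symm ▸ ht⟩ : ℍ) =
      ⟨I * t⁻¹, (Complex.I_mul_im t⁻¹).symm ▸ inv_re_pos ht⟩ := by
  rw [modular_S_smul]
  ext
  simp [mul_comm]

theorem lambertEis_inv {m : ℕ} (hm : 1 ≤ m) {t : ℂ} (ht : 0 < t.re) :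
    lambertEis m t - bernSum (1 - 2 * m) t 0 0 =
      (-I * t) ^ (-(2 * m : ℕ) : ℤ) * lambertEis m t⁻¹ := by
  have ht0 := ne_zero_of_re_pos ht
  have hpi : (π : ℂ) ≠ 0 := by exact_mod_cast Real.pi_ne_zero
  have hI := I_ne_zero
  have hIt : (-I * t) ^ (2 * m) ≠ 0 := pow_ne_zero _ (neg_I_mul_ne_zero ht)
  rw [zpow_neg, zpow_natCast, eq_inv_mul_iff_mul_eq₀ hIt]
  rcases hm.eq_or_lt with rfl | hm
  · have h1 := lambertEis_one ht
    have h2 := lambertEis_one (inv_re_pos ht)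
    have h3 := G2_S_transform ⟨I * t, (Complex.I_mul_im t).symm ▸ ht⟩
    rw [S_smul_I_mul ht, ← h1, ← h2] at h3
    simp only at h3
    have hb : bernSum (1 - 2 * (1 : ℕ)) t 0 0 = (-2 * (π : ℂ))⁻¹ * t⁻¹ := bernSum_neg_one t 0 0
    rw [hb]
    rw [show (-2 * π * I : ℂ) ^ 2 = -4 * π ^ 2 by rw [mul_pow, I_sq]; ring,
      mul_pow, I_sq, mul_div_mul_comm, mul_div_assoc] at h3
    rw [show (-I * t) ^ (2 * 1) = -t ^ 2 by rw [mul_pow]; simp]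
    field_simp at h3 ⊢
    linear_combination h3 / 2
  · rw [bernSum_of_lt (by lia), sub_zero]
    have h1 := lambertEis_eq_tsum hm ht
    have h2 := lambertEis_eq_tsum hm (inv_re_pos ht)
    rw [← S_smul_I_mul ht, tsum_eisSummand_smul_S, ← h1, mul_left_comm] at h2
    have hc : (-2 * π * I : ℂ) ^ (2 * m) / ((2 * m - 1).factorial : ℂ) ≠ 0 :=
      div_ne_zero (pow_ne_zero _ (by simp [hpi]))
        (by exact_mod_cast Nat.factorial_ne_zero _)
    have h3 := mul_left_cancel₀ hc h2
    rw [h3]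
    congr 1
    simp [mul_pow, pow_mul]

end

section

open Filter Topology HurwitzZeta

/-- One side of the transformation formula, in terms of Lambert series. -/
def lambertP (k : ℤ) (t : ℂ) (a b : ℝ) : ℂ :=
  dInt b * expZeta (a : UnitAddCircle) k + lambertU k t (2 * π * (t * fracP b - I * a)) +
    (-1) ^ (k - 1) * lambertU k t (2 * π * (t * fracP (-b) + I * a))

theorem expSeries_sub_int_mul_two_pi_I (c : ℕ → ℂ) (w : ℂ) (n : ℤ) :
    expSeries c (w - n * (2 * π * I)) = expSeries c w := by
  have h : Function.Periodic (expSeries c) (2 * π * I) := expSeries_add_two_pi_I c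
  exact h.sub_int_mul_eq n

theorem lambertP_add_int (k : ℤ) (t : ℂ) (a b : ℝ) (m n : ℤ) :
    lambertP k t (a + m) (b + n) = lambertP k t a b := by
  have h1 : dInt (b + n) = dInt b := by
    unfold dInt
    congr 1
    refine propext ⟨fun ⟨l, hl⟩ => ⟨l - n, by push_cast; linarith⟩,
      fun ⟨l, hl⟩ => ⟨l + n, by push_cast; linarith⟩⟩
  have h2 : ((a + m : ℝ) : UnitAddCircle) = (a : UnitAddCircle) := by
    rw [AddCircle.coe_add]
    have : ((m : ℝ) : UnitAddCircle) = 0 := (AddCircle.coe_eq_zero_iff 1).mpr ⟨m, by simp⟩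
    rw [this, add_zero]
  have h3 : fracP (b + n) = fracP b := by
    unfold fracP
    rw [show -(b + n) = -b - n by ring, Int.fract_sub_intCast]
  have h4 : fracP (-(b + n)) = fracP (-b) := by
    unfold fracP
    rw [neg_neg, neg_neg, Int.fract_add_intCast]
  rw [lambertP, lambertP, h1, h2, h3, h4]
  unfold lambertU
  rw [← expSeries_sub_int_mul_two_pi_I _ (2 * π * (t * fracP b - I * a)) m,
    ← expSeries_sub_int_mul_two_pi_I _ (2 * π * (t * fracP (-b) + I * (a + m : ℝ))) m]
  congr 4
  · push_cast; ring
  · push_cast; ring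

theorem lambertP_of_mem_Ioo (k : ℤ) (t : ℂ) (a : ℝ) {b : ℝ} (hb : b ∈ Set.Ioo (0 : ℝ) 1) :
    lambertP k t a b = lambertV k t (2 * π * (t * b - I * a)) := by
  have h1 : dInt b = 0 := by
    refine if_neg fun ⟨n, hn⟩ => ?_
    rw [← hn] at hb
    have h1 : (0 : ℤ) < n := by exact_mod_cast hb.1
    have h2 : n < (1 : ℤ) := by exact_mod_cast hb.2
    lia
  have hf : Int.fract b = b := Int.fract_eq_self.mpr ⟨hb.1.le, hb.2⟩
  have h3 : fracP (-b) = 1 - b := by rw [fracP, neg_neg, hf]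
  have h2 : fracP b = b := by
    rw [fracP, Int.fract_neg (by rw [hf]; exact hb.1.ne'), hf, sub_sub_cancel]
  rw [lambertP, h1, h2, h3, zero_mul, zero_add, lambertV]
  congr 3
  push_cast; ring

theorem lambertP_zero_right (k : ℤ) (t : ℂ) (a : ℝ) :
    lambertP k t a 0 = expZeta (a : UnitAddCircle) k + lambertU k t (2 * π * (t - I * a)) +
      (-1) ^ (k - 1) * lambertU k t (2 * π * (t + I * a)) := by
  have h1 : dInt 0 = 1 := if_pos ⟨0, by simp⟩
  have h2 : fracP 0 = 1 := by simp [fracP]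
  rw [lambertP, neg_zero, h1, h2]
  simp

theorem tendsto_lambertV_zero {k : ℤ} {t : ℂ} (ht : 0 < t.re) {a : ℝ}
    (h : 2 ≤ k ∨ k ≠ 1 ∧ a ∈ Set.Ioo (0 : ℝ) 1) :
    Tendsto (fun x : ℝ => lambertV k t (2 * π * (t * x - I * a))) (𝓝[>] 0)
      (𝓝 (lambertP k t a 0)) := by
  have hp : 0 < 2 * π * t.re := by positivity
  have hU : ∀ w : ℂ, 0 < w.re → ContinuousAt (lambertU k t) w := fun w hw =>
    (hasDerivAt_lambertU k ht hw).continuousAt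
  have h1 : Tendsto (fun x : ℝ => lambertU k t (2 * π * (t * x - I * a) + 2 * π * t)) (𝓝[>] 0)
      (𝓝 (lambertU k t (2 * π * (t - I * a)))) := by
    refine (hU _ (by simpa using hp)).tendsto.comp
      (Tendsto.mono_left ?_ (nhdsWithin_le_nhds (s := Set.Ioi (0 : ℝ))))
    exact Continuous.tendsto' (by fun_prop) _ _ (by push_cast; ring)
  have h2 : Tendsto (fun x : ℝ => lambertU k t (2 * π * t - 2 * π * (t * x - I * a))) (𝓝[>] 0)
      (𝓝 (lambertU k t (2 * π * (t + I * a)))) := by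
    refine (hU _ (by simpa using hp)).tendsto.comp
      (Tendsto.mono_left ?_ (nhdsWithin_le_nhds (s := Set.Ioi (0 : ℝ))))
    exact Continuous.tendsto' (by fun_prop) _ _ (by push_cast; ring)
  rw [lambertP_zero_right]
  refine (((tendsto_expSeries_liCoeff ht h).add h1).add
    (h2.const_mul ((-1 : ℂ) ^ (k - 1)))).congr' ?_
  filter_upwards [self_mem_nhdsWithin] with x hx
  have hw : 0 < (2 * π * (t * x - I * a) : ℂ).re := by
    rw [re_left_arg]; exact mul_pos hp hx
  rw [lambertV, lambertU_sub_shift k ht (w := 2 * π * (t * x - I * a)) (Or.inl hw)]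

theorem lambertV_zero {k : ℤ} (hk : 2 ≤ k) {t : ℂ} (ht : 0 < t.re) :
    lambertV k t 0 = lambertP k t 0 0 := by
  have h := expSeries_liCoeff_eq_expZeta hk 0
  rw [lambertP_zero_right, lambertV, lambertU_sub_shift k ht (Or.inr ⟨hk, by simp⟩)]
  simp at h ⊢
  exact h

theorem lambertDefect_zero_zero {k : ℤ} (hk : 2 ≤ k) {t : ℂ} (ht : 0 < t.re) :
    lambertDefect k t 0 0 = 0 := by
  have h1 : ContinuousOn (fun x : ℝ => lambertDefect k t x x) (Set.Icc 0 1) :=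
    (continuousOn_lambertDefect hk ht).comp (f := fun x : ℝ => (x, x)) (by fun_prop)
      fun x hx => ⟨hx, hx⟩
  have h2 : Tendsto (fun x : ℝ => lambertDefect k t x x) (𝓝[Set.Ioo 0 1] 0)
      (𝓝 (lambertDefect k t 0 0)) :=
    (h1 0 ⟨le_rfl, zero_le_one⟩).mono_left (nhdsWithin_mono _ Set.Ioo_subset_Icc_self)
  have h3 : Tendsto (fun x : ℝ => lambertDefect k t x x) (𝓝[Set.Ioo 0 1] 0) (𝓝 0) :=
    tendsto_const_nhds.congr' (by
      filter_upwards [self_mem_nhdsWithin] with x hx using (lambertDefect_eq_zero k ht hx hx).symm)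
  have : (𝓝[Set.Ioo 0 1] (0 : ℝ)).NeBot := by
    rw [nhdsWithin_Ioo_eq_nhdsGT zero_lt_one]; infer_instance
  exact tendsto_nhds_unique h2 h3

theorem lambertP_zero_zero (k : ℤ) (t : ℂ) :
    lambertP k t 0 0 = riemannZeta k + (1 + (-1) ^ (k - 1)) * lambertU k t (2 * π * t) := by
  rw [lambertP_zero_right]
  simp [expZeta_zero]
  ring

theorem lambertP_transform_zero_zero {k : ℤ} (hk : k ≠ 1) {t : ℂ} (ht : 0 < t.re) :
    lambertP k t 0 0 - bernSum k t 0 0 = (-I * t) ^ (k - 1) * lambertP k t⁻¹ 0 0 := by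
  have ht0 := ne_zero_of_re_pos ht
  by_cases hk2 : 2 ≤ k
  · have h := lambertDefect_zero_zero hk2 ht
    rw [lambertDefect] at h
    simp only [ofReal_zero, mul_zero, sub_zero, add_zero] at h
    rw [lambertV_zero hk2 ht, lambertV_zero hk2 (inv_re_pos ht)] at h
    exact sub_eq_zero.mp h
  rcases Int.even_or_odd k with hev | hodd
  · have hs : (-1 : ℂ) ^ (k - 1) = -1 := (hev.sub_odd odd_one).neg_one_zpow
    rw [lambertP_zero_zero, lambertP_zero_zero, hs, add_neg_cancel, zero_mul, zero_mul, add_zero]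
    obtain ⟨m, rfl⟩ := hev
    rcases eq_or_ne m 0 with rfl | hm
    · have hb := bernSum_natCast 0 t 0 0
      have h1 : bernDiv 1 0 = -1 / 2 := by
        simp [bernDiv, BpolyC, Polynomial.bernoulli_one]
        ring
      simp [Finset.sum_range_succ, bernDiv_zero, h1] at hb
      simp [riemannZeta_zero, hb]
      ring
    · obtain ⟨n, hn⟩ := Int.eq_ofNat_of_zero_le (show 0 ≤ -m - 1 by lia)
      have hz : riemannZeta ((m + m : ℤ) : ℂ) = 0 := by
        rw [← riemannZeta_neg_two_mul_nat_add_one n]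
        congr 1
        rw [show m = -(n + 1) by lia]
        push_cast; ring
      rw [hz, bernSum_of_lt (by lia)]
      simp
  · obtain ⟨n, rfl⟩ := hodd
    obtain ⟨m, hm⟩ := Int.eq_ofNat_of_zero_le (show 0 ≤ -n by lia)
    obtain rfl : n = -(m : ℤ) := by lia
    rw [show 2 * -(m : ℤ) + 1 = 1 - 2 * m by ring]
    have hP : ∀ t : ℂ, lambertP (1 - 2 * m) t 0 0 = lambertEis m t := fun t => by
      rw [lambertP_zero_zero, lambertEis]
      have hs : (-1 : ℂ) ^ (1 - 2 * m - 1 : ℤ) = 1 :=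
        Even.neg_one_zpow ⟨-(m : ℤ), by ring⟩
      rw [hs]; push_cast; ring
    rw [hP, hP, lambertEis_inv (by lia) ht]
    congr 2
    push_cast; ring

theorem tendsto_lambertV_right {k : ℤ} {t : ℂ} (ht : 0 < t.re) {b : ℝ}
    (hb : b ∈ Set.Ioo (0 : ℝ) 1) {f : ℝ → ℂ} (hf : Continuous f) (h0 : f 0 = 2 * π * (t * b)) :
    Tendsto (fun x => lambertV k t (f x)) (𝓝[>] 0) (𝓝 (lambertP k t 0 b)) := by
  have hp : 0 < 2 * π * t.re := by positivity
  have hre : (2 * π * (t * b) : ℂ).re = 2 * π * t.re * b := by simp; ring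
  have hc : ContinuousAt (lambertV k t) (2 * π * (t * b)) := by
    refine (hasDerivAt_lambertV k ht ?_ ?_).continuousAt
    · rw [hre]; exact mul_pos hp hb.1
    · rw [hre]; nlinarith [hb.2]
  rw [lambertP_of_mem_Ioo k t 0 hb, ofReal_zero, mul_zero, sub_zero]
  exact hc.tendsto.comp (Tendsto.mono_left (hf.tendsto' _ _ h0) nhdsWithin_le_nhds)

theorem lambertP_transform_zero_right {k : ℤ} (hk : k ≠ 1) {t : ℂ} (ht : 0 < t.re) {a : ℝ}
    (ha : a ∈ Set.Ioo (0 : ℝ) 1) :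
    lambertP k t a 0 - bernSum k t a 0 = (-I * t) ^ (k - 1) * lambertP k t⁻¹ 0 a := by
  have h1 := tendsto_lambertV_zero ht (Or.inr ⟨hk, ha⟩)
  have h2 : Tendsto (fun x : ℝ => bernSum k t a x) (𝓝[>] 0) (𝓝 (bernSum k t a 0)) := by
    refine Tendsto.mono_left ?_ nhdsWithin_le_nhds
    exact Continuous.tendsto' ((continuous_bernSum k t).comp (f := fun x : ℝ => ((a : ℂ), (x : ℂ)))
      (by fun_prop)) _ _ (by simp)
  have h3 : Tendsto (fun x : ℝ => lambertV k t⁻¹ (2 * π * (t⁻¹ * a + I * x))) (𝓝[>] 0)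
      (𝓝 (lambertP k t⁻¹ 0 a)) :=
    tendsto_lambertV_right (inv_re_pos ht) ha (by fun_prop) (by simp)
  have h := (h1.sub h2).sub (h3.const_mul ((-I * t) ^ (k - 1)))
  refine sub_eq_zero.mp (tendsto_nhds_unique h (tendsto_const_nhds.congr' ?_))
  filter_upwards [Ioo_mem_nhdsGT (show (0 : ℝ) < 1 by norm_num)] with x hx
  exact (lambertDefect_eq_zero k ht ha hx).symm

theorem lambertP_transform_zero_left {k : ℤ} (hk : k ≠ 1) {t : ℂ} (ht : 0 < t.re) {b : ℝ}
    (hb : b ∈ Set.Ioo (0 : ℝ) 1) :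
    lambertP k t 0 b - bernSum k t 0 b = (-I * t) ^ (k - 1) * lambertP k t⁻¹ (-b) 0 := by
  have h1 : Tendsto (fun x : ℝ => lambertV k t (2 * π * (t * b - I * x))) (𝓝[>] 0)
      (𝓝 (lambertP k t 0 b)) :=
    tendsto_lambertV_right ht hb (by fun_prop) (by simp)
  have h2 : Tendsto (fun x : ℝ => bernSum k t x b) (𝓝[>] 0) (𝓝 (bernSum k t 0 b)) := by
    refine Tendsto.mono_left ?_ nhdsWithin_le_nhds
    exact Continuous.tendsto' ((continuous_bernSum k t).comp (f := fun x : ℝ => ((x : ℂ), (b : ℂ)))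
      (by fun_prop)) _ _ (by simp)
  have h3 : Tendsto (fun x : ℝ => lambertV k t⁻¹ (2 * π * (t⁻¹ * x + I * b))) (𝓝[>] 0)
      (𝓝 (lambertP k t⁻¹ (-b) 0)) := by
    have h := tendsto_lambertV_zero (inv_re_pos ht) (k := k) (a := 1 - b)
      (Or.inr ⟨hk, by linarith [hb.2], by linarith [hb.1]⟩)
    have hP := lambertP_add_int k t⁻¹ (-b) 0 1 0
    rw [Int.cast_zero, Int.cast_one, add_zero, neg_add_eq_sub] at hP
    rw [hP] at h
    refine h.congr fun x => ?_
    rw [← lambertV_add_two_pi_I]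
    congr 1; push_cast; ring
  have h := (h1.sub h2).sub (h3.const_mul ((-I * t) ^ (k - 1)))
  refine sub_eq_zero.mp (tendsto_nhds_unique h (tendsto_const_nhds.congr' ?_))
  filter_upwards [Ioo_mem_nhdsGT (show (0 : ℝ) < 1 by norm_num)] with x hx
  exact (lambertDefect_eq_zero k ht hx hb).symm

theorem lambertP_transform {k : ℤ} {t : ℂ} (ht : 0 < t.re) {a b : ℝ} (ha : a ∈ Set.Ico (0 : ℝ) 1)
    (hb : b ∈ Set.Ico (0 : ℝ) 1) (h : k = 1 → a ≠ 0 ∧ b ≠ 0) :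
    lambertP k t a b - bernSum k t a b = (-I * t) ^ (k - 1) * lambertP k t⁻¹ (-b) a := by
  rcases ha.1.eq_or_lt with rfl | ha0 <;> rcases hb.1.eq_or_lt with rfl | hb0
  · simpa using lambertP_transform_zero_zero (fun hk => (h hk).1 rfl) ht
  · simpa using lambertP_transform_zero_left (fun hk => (h hk).1 rfl) ht ⟨hb0, hb.2⟩
  · simpa using lambertP_transform_zero_right (fun hk => (h hk).2 rfl) ht ⟨ha0, ha.2⟩
  · have hD := lambertDefect_eq_zero k ht ⟨ha0, ha.2⟩ ⟨hb0, hb.2⟩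
    rw [lambertP_of_mem_Ioo _ _ _ ⟨hb0, hb.2⟩, lambertP_of_mem_Ioo _ _ _ ⟨ha0, ha.2⟩]
    rw [lambertDefect] at hD
    push_cast
    rw [mul_neg, sub_neg_eq_add]
    exact sub_eq_zero.mp hD

end

theorem lambertP_eq_Scal (k : ℤ) (a b : ℝ) {t : ℂ} (ht : 0 < t.re) :
    lambertP k t a b = dInt b * HurwitzZeta.expZeta (a : UnitAddCircle) k +
      Scal (k : ℂ) b 0 0 a t + (-1) ^ (k - 1) * Scal (k : ℂ) (-b) 0 0 (-a) t := by
  rw [lambertP, Scal_eq_lambertU k a b ht, Scal_eq_lambertU k (-a) (-b) ht]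
  push_cast
  rw [mul_neg, sub_neg_eq_add]

theorem bernSum_eq_sum (k : ℤ) (t a b : ℂ) :
    bernSum k t a b = (-2 * (π : ℂ)) ^ k * ∑ j ∈ Finset.range (k + 2).toNat,
      (-I) ^ j * BpolyC j a * BpolyC ((k + 1).toNat - j) b /
        ((Nat.factorial j : ℂ) * (Nat.factorial ((k + 1).toNat - j) : ℂ)) * t ^ (k - (j : ℤ)) := by
  rw [bernSum]
  congr 1
  refine Finset.sum_congr rfl fun j _ => ?_
  rw [bernDiv, bernDiv]
  ring

theorem lambertP_eq_fract (k : ℤ) (t : ℂ) (a b : ℝ) :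
    lambertP k t a b = lambertP k t (Int.fract a) (Int.fract b) := by
  rw [← lambertP_add_int k t (Int.fract a) (Int.fract b) ⌊a⌋ ⌊b⌋, Int.fract_add_floor,
    Int.fract_add_floor]

theorem lambertP_neg_eq_fract (k : ℤ) (t : ℂ) (a b : ℝ) :
    lambertP k t (-a) b = lambertP k t (-Int.fract a) (Int.fract b) := by
  rw [← lambertP_add_int k t (-Int.fract a) (Int.fract b) (-⌊a⌋) ⌊b⌋, Int.fract_add_floor]
  congr 1
  rw [Int.fract]; push_cast; ring

/-- Corollary 4.1 of the paper: the pairing of `ζ_α(k)` and `ζ_{-β}(k)`. -/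
theorem statement4 (α β : ℝ) (k : ℤ)
    (hk : k = 1 → (¬∃ n : ℤ, (n : ℝ) = α) ∧ (¬∃ n : ℤ, (n : ℝ) = β))
    (τ : ℂ) (hτ : 0 < τ.re) :
    dInt β * HurwitzZeta.expZeta (α : UnitAddCircle) ((k : ℤ) : ℂ) + Scal (k : ℂ) β 0 0 α τ +
          (-1 : ℂ) ^ (k - 1) * Scal (k : ℂ) (-β) 0 0 (-α) τ -
        (-2 * (Real.pi : ℂ)) ^ k *
          ∑ j ∈ Finset.range (k + 2).toNat,
            (-Complex.I) ^ j * BpolyC j ((Int.fract α : ℝ) : ℂ) *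
                BpolyC ((k + 1).toNat - j) ((Int.fract β : ℝ) : ℂ) /
                ((Nat.factorial j : ℂ) * (Nat.factorial ((k + 1).toNat - j) : ℂ)) *
              τ ^ (k - (j : ℤ)) =
      (-Complex.I * τ) ^ (k - 1) *
        (dInt α * HurwitzZeta.expZeta ((-β : ℝ) : UnitAddCircle) ((k : ℤ) : ℂ) +
          Scal (k : ℂ) α 0 0 (-β) (1 / τ) +
          (-1 : ℂ) ^ (k - 1) * Scal (k : ℂ) (-α) 0 0 β (1 / τ)) := by
  have h := lambertP_transform hτ ⟨Int.fract_nonneg α, Int.fract_lt_one α⟩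
    ⟨Int.fract_nonneg β, Int.fract_lt_one β⟩ fun h1 =>
      ⟨fun h0 => (hk h1).1 ⟨⌊α⌋, by rw [← Int.self_sub_fract, h0, sub_zero]⟩,
        fun h0 => (hk h1).2 ⟨⌊β⌋, by rw [← Int.self_sub_fract, h0, sub_zero]⟩⟩
  rw [← lambertP_eq_fract, ← lambertP_neg_eq_fract, lambertP_eq_Scal k α β hτ,
    lambertP_eq_Scal k (-β) α (inv_re_pos hτ), neg_neg, bernSum_eq_sum] at h
  rw [one_div]
  exact h

end
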